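/- For every integer n ≥ 3 there exist a Ważewski dendrite X of order n and a finitely generated subgroup G of Homeo(X), dense in Homeo(X), whose abelianization G/[G,G] is isomorphic to (ℤ/2ℤ) × ℤ; in particular the commutator subgroup [G,G] has infinite index in G. -/

import Mathlib

open Topology

/-- The set of connected components of a subset `S` of `X`. -/
def setComponents (X : Type*) [TopologicalSpace X] (S : Set X) : Set (Set X) :=
  {C | ∃ x ∈ S, C = connectedComponentIn S x}

/-- The order of a point `p` of `X`: the number of connected components of `X \ {p}`. -/
noncomputable def ptOrder (X : Type*) [TopologicalSpace X] (p : X) : ℕ :=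
  (setComponents X {p}ᶜ).ncard

/-- A dendrite: a nonempty, compact, connected, locally connected metrizable space
containing no subspace homeomorphic to the circle. -/
def IsDendrite (X : Type*) [TopologicalSpace X] : Prop :=
  Nonempty X ∧ CompactSpace X ∧ ConnectedSpace X ∧ LocallyConnectedSpace X ∧
    TopologicalSpace.MetrizableSpace X ∧
    ∀ S : Set X, IsEmpty (S ≃ₜ Circle)

/-- A Ważewski dendrite of order `n`: a dendrite all of whose points have order `1`, `2`
or `n`, and every arc (subspace homeomorphic to `[0,1]`) contains a point of order `n`. -/
def IsWazewskiDendrite (n : ℕ) (X : Type*) [TopologicalSpace X] : Prop :=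
  IsDendrite X ∧
  (∀ p : X, ptOrder X p = 1 ∨ ptOrder X p = 2 ∨ ptOrder X p = n) ∧
  ∀ A : Set X, Nonempty (A ≃ₜ unitInterval) → ∃ p ∈ A, ptOrder X p = n

/-- The group structure on self-homeomorphisms of `X`, with composition as product. -/
instance Homeomorph.instGroupSelf (X : Type*) [TopologicalSpace X] : Group (X ≃ₜ X) where
  mul f g := g.trans f
  one := Homeomorph.refl X
  inv := Homeomorph.symm
  mul_assoc _ _ _ := rfl
  one_mul _ := Homeomorph.ext fun _ => rfl
  mul_one _ := Homeomorph.ext fun _ => rfl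
  inv_mul_cancel := Homeomorph.self_trans_symm

/-- The compact-open topology on the group of self-homeomorphisms of `X` (for compact
metric `X`, this is the topology of uniform convergence). -/
instance Homeomorph.instTopSelf (X : Type*) [TopologicalSpace X] :
    TopologicalSpace (X ≃ₜ X) :=
  TopologicalSpace.induced (fun h : X ≃ₜ X => (h : C(X, X))) ContinuousMap.compactOpen

namespace Waz

/-- Letters: two special ones and `k` more. -/
inductive Lt (k : ℕ) : Type
  | p : Lt k
  | q : Lt k
  | h (j : Fin k) : Lt k

instance {k : ℕ} : DecidableEq (Lt k)
  | .p, .p => isTrue rfl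
  | .q, .q => isTrue rfl
  | .h i, .h j => if hij : i = j then isTrue (by rw [hij]) else isFalse (by simpa using hij)
  | .p, .q => isFalse (by simp)
  | .p, .h _ => isFalse (by simp)
  | .q, .p => isFalse (by simp)
  | .q, .h _ => isFalse (by simp)
  | .h _, .p => isFalse (by simp)
  | .h _, .q => isFalse (by simp)

/-- Types of cells. -/
inductive Ty : Type
  | O : Ty
  | L : Ty
  | E : Ty

instance : DecidableEq Ty
  | .O, .O => isTrue rfl
  | .L, .L => isTrue rfl
  | .E, .E => isTrue rfl
  | .O, .L => isFalse (by simp)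
  | .O, .E => isFalse (by simp)
  | .L, .O => isFalse (by simp)
  | .L, .E => isFalse (by simp)
  | .E, .O => isFalse (by simp)
  | .E, .L => isFalse (by simp)

open Lt

/-- Words (branch points). -/
abbrev W (k : ℕ) := List (Lt k)

/-- Points seen from a cell: words or one of two boundary tokens. -/
abbrev Pt (k : ℕ) := W k ⊕ Bool

variable {k : ℕ}

/-- Type of a child cell. -/
def ch : Ty → Lt k → Ty
  | .O, _ => .L
  | .L, .p => .E
  | .L, .q => .L
  | .L, .h _ => .L
  | .E, .p => .E
  | .E, .q => .E
  | .E, .h _ => .L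

/-- Letter of the child adjacent to a boundary token. -/
def adj : Ty → Bool → Lt k
  | .O, _ => .p
  | .L, _ => .p
  | .E, false => .p
  | .E, true => .q

/-- Direction from the centre. -/
def fs (τ : Ty) : Pt k → Lt k
  | .inl [] => .p
  | .inl (b :: _) => b
  | .inr s => adj τ s

/-- How a point is seen from the child `a`. -/
def pr (τ : Ty) (a : Lt k) : Pt k → Pt k
  | .inl [] => .inr true
  | .inl (b :: w) => if b = a then .inl w else .inr true
  | .inr s => if adj τ s = a then .inr false else .inr true

/-- Direction at the word `m` towards a point. -/
def dir : Ty → W k → Pt k → Lt k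
  | τ, [], x => fs τ x
  | τ, a :: m, x => dir (ch τ a) m (pr τ a x)

@[simp] lemma dir_nil (τ : Ty) (x : Pt k) : dir τ [] x = fs τ x := rfl
@[simp] lemma dir_cons (τ : Ty) (a : Lt k) (m : W k) (x : Pt k) :
    dir τ (a :: m) x = dir (ch τ a) m (pr τ a x) := rfl
@[simp] lemma fs_cons (τ : Ty) (b : Lt k) (w : W k) : fs τ (.inl (b :: w)) = b := rfl
@[simp] lemma fs_tok (τ : Ty) (s : Bool) : fs τ (.inr s : Pt k) = adj τ s := rfl
@[simp] lemma pr_nil (τ : Ty) (a : Lt k) : pr τ a (.inl []) = .inr true := rfl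
@[simp] lemma pr_cons (τ : Ty) (a b : Lt k) (w : W k) :
    pr τ a (.inl (b :: w)) = if b = a then .inl w else .inr true := rfl
@[simp] lemma pr_tok (τ : Ty) (a : Lt k) (s : Bool) :
    pr τ a (.inr s) = if adj τ s = a then .inr false else .inr true := rfl
@[simp] lemma ch_O (a : Lt k) : ch .O a = .L := rfl
@[simp] lemma ch_Lp : ch .L (p : Lt k) = .E := rfl
@[simp] lemma ch_Lq : ch .L (q : Lt k) = .L := rfl
@[simp] lemma ch_Lh (j : Fin k) : ch .L (h j : Lt k) = .L := rfl
@[simp] lemma ch_Ep : ch .E (p : Lt k) = .E := rfl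
@[simp] lemma ch_Eq : ch .E (q : Lt k) = .E := rfl
@[simp] lemma ch_Eh (j : Fin k) : ch .E (h j : Lt k) = .L := rfl
@[simp] lemma adj_O (s : Bool) : adj .O s = (p : Lt k) := rfl
@[simp] lemma adj_L (s : Bool) : adj .L s = (p : Lt k) := rfl
@[simp] lemma adj_Ef : adj .E false = (p : Lt k) := rfl
@[simp] lemma adj_Et : adj .E true = (q : Lt k) := rfl

lemma pr_of_fs_ne {τ : Ty} {a : Lt k} {x : Pt k} (hx : fs τ x ≠ a) : pr τ a x = .inr true := by
  rcases x with (_ | ⟨b, w⟩) | s <;> simp_all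

lemma pr_ne {τ : Ty} {a : Lt k} {m : W k} {x : Pt k} (hx : x ≠ .inl (a :: m)) :
    pr τ a x ≠ .inl m := by
  rcases x with (_ | ⟨b, w⟩) | s
  · simp
  · by_cases hb : b = a
    · subst hb; simpa using hx
    · simp [hb]
  · simp only [pr_tok]; split <;> simp

/-- Axiom A1. -/
lemma dir_sep (m : W k) : ∀ (τ : Ty) (m' : W k) (x : Pt k), x ≠ .inl m → x ≠ .inl m' → m ≠ m' →
    dir τ m x ≠ dir τ m (.inl m') → dir τ m' x = dir τ m' (.inl m) := by
  induction m with
  | nil =>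
    intro τ m' x hx hx' hm hd
    cases m' with
    | nil => exact absurd rfl hm
    | cons b m' =>
      simp only [dir_nil, fs_cons] at hd
      simp [pr_of_fs_ne hd]
  | cons a m ih =>
    intro τ m' x hx hx' hm hd
    have key : dir (ch τ a) m (pr τ a x) ≠ dir (ch τ a) m (.inr true) → fs τ x = a := by
      intro h1
      by_contra h2
      exact h1 (by rw [pr_of_fs_ne h2])
    cases m' with
    | nil => simpa using key (by simpa using hd)
    | cons b m' =>
      by_cases hab : b = a
      · subst hab
        simp only [dir_cons, pr_cons, if_true] at hd ⊢
        exact ih _ m' _ (pr_ne hx) (pr_ne hx') (by simpa using hm) hd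
      · have h1 := key (by simpa [hab] using hd)
        have h2 : fs τ x ≠ b := by rw [h1]; exact fun h => hab h.symm
        have hab' : a ≠ b := fun h => hab h.symm
        simp [pr_of_fs_ne h2, hab']

@[simp] lemma dir_append (m : W k) : ∀ (τ : Ty) (a : Lt k) (w : W k),
    dir τ m (.inl (m ++ a :: w)) = a := by
  induction m with
  | nil => intro τ a w; simp
  | cons b m ih => intro τ a w; simp [ih]

/-- Density towards the boundary. -/
lemma dense_tok (m : W k) : ∀ (τ : Ty) (s : Bool), τ ≠ .O →
    ∃ x : W k, x ≠ m ∧ dir τ x (.inl m) ≠ dir τ x (.inr s) := by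
  induction m with
  | nil =>
    intro τ s hτ
    refine ⟨[adj τ s], by simp, ?_⟩
    have : ch τ (adj τ s : Lt k) = .E := by
      cases τ <;> cases s <;> simp_all
    simp [this]
  | cons a m ih =>
    intro τ s hτ
    by_cases h1 : a = adj τ s
    · obtain ⟨x, hx, hd⟩ := ih (ch τ a) false (by subst h1; cases τ <;> cases s <;> simp_all)
      refine ⟨a :: x, by simpa using hx, ?_⟩
      simpa [h1] using (h1 ▸ hd)
    · exact ⟨[], by simp, by simpa using h1⟩

lemma dir_dense (m : W k) : ∀ (τ : Ty) (m' : W k), m ≠ m' →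
    ∃ x : W k, x ≠ m ∧ x ≠ m' ∧ dir τ x (.inl m) ≠ dir τ x (.inl m') := by
  have aux : ∀ (τ : Ty) (b : Lt k), ch τ b ≠ .O := by
    intro τ b; cases τ <;> cases b <;> simp
  induction m with
  | nil =>
    intro τ m' hm
    cases m' with
    | nil => exact absurd rfl hm
    | cons b m' =>
      obtain ⟨x, hx, hd⟩ := dense_tok m' (ch τ b) true (aux τ b)
      exact ⟨b :: x, by simp, by simpa using hx, by simpa using hd.symm⟩
  | cons a m ih =>
    intro τ m' hm
    cases m' with
    | nil =>
      obtain ⟨x, hx, hd⟩ := dense_tok m (ch τ a) true (aux τ a)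
      exact ⟨a :: x, by simpa using hx, by simp, by simpa using hd⟩
    | cons b m' =>
      by_cases hab : a = b
      · subst hab
        obtain ⟨x, hx, hx', hd⟩ := ih (ch τ a) m' (by simpa using hm)
        exact ⟨a :: x, by simpa using hx, by simpa using hx', by simpa using hd⟩
      · exact ⟨[], by simp, by simp, by simpa using hab⟩

/-- `c` does not see the two points in the same direction. -/
def Apart (τ : Ty) (c : W k) (x y : Pt k) : Prop :=
  x = .inl c ∨ y = .inl c ∨ dir τ c x ≠ dir τ c y

lemma Apart.cons {τ : Ty} {a : Lt k} {c : W k} {x y : Pt k}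
    (hx : ∀ w, pr τ a x = .inl w → x = .inl (a :: w))
    (hy : ∀ w, pr τ a y = .inl w → y = .inl (a :: w))
    (hh : Apart (ch τ a) c (pr τ a x) (pr τ a y)) : Apart τ (a :: c) x y := by
  rcases hh with hh | hh | hh
  · exact Or.inl (hx _ hh)
  · exact Or.inr (Or.inl (hy _ hh))
  · exact Or.inr (Or.inr hh)

lemma pr_inl {τ : Ty} {a : Lt k} {x : Pt k} (w : W k) (hw : pr τ a x = .inl w) :
    x = .inl (a :: w) := by
  by_contra hne
  exact pr_ne hne hw

lemma med1 (m : W k) : ∃ c : W k, Apart .E c (.inl m) (.inr false) ∧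
    Apart .E c (.inl m) (.inr true) ∧ Apart .E c (.inr false : Pt k) (.inr true) := by
  induction m with
  | nil => exact ⟨[], by simp [Apart], by simp [Apart], by simp [Apart]⟩
  | cons a m ih =>
    obtain ⟨c, h1, h2, h3⟩ := ih
    have sym : ∀ {τ : Ty} {c : W k} {x y : Pt k}, Apart τ c x y → Apart τ c y x := by
      intro τ c x y hh
      rcases hh with hh | hh | hh
      · exact Or.inr (Or.inl hh)
      · exact Or.inl hh
      · exact Or.inr (Or.inr hh.symm)
    cases a with
    | p =>
      exact ⟨p :: c, Apart.cons pr_inl pr_inl (by simpa using h1),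
        Apart.cons pr_inl pr_inl (by simpa using h2), Apart.cons pr_inl pr_inl (by simpa using h3)⟩
    | q =>
      exact ⟨q :: c, Apart.cons pr_inl pr_inl (by simpa using h2),
        Apart.cons pr_inl pr_inl (by simpa using h1),
        Apart.cons pr_inl pr_inl (by simpa using sym h3)⟩
    | h j => exact ⟨[], by simp [Apart], by simp [Apart], by simp [Apart]⟩

lemma Apart.symm {τ : Ty} {c : W k} {x y : Pt k} (hh : Apart τ c x y) : Apart τ c y x := by
  rcases hh with hh | hh | hh
  · exact Or.inr (Or.inl hh)
  · exact Or.inl hh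
  · exact Or.inr (Or.inr hh.symm)

lemma ch_ne_O (τ : Ty) (b : Lt k) : ch τ b ≠ .O := by cases τ <;> cases b <;> simp

lemma ch_adj {τ : Ty} (hτ : τ ≠ .O) (s : Bool) : ch τ (adj τ s : Lt k) = .E := by
  cases τ <;> cases s <;> simp_all

/-- Apart from the boundary on one side: `m` in the child adjacent to `s`, the other not. -/
lemma med_adj {τ : Ty} (hτ : τ ≠ .O) (s : Bool) (m : W k) (y : Pt k)
    (hy : fs τ y ≠ adj τ s ∨ y = .inl []) :
    ∃ c : W k, Apart τ c (.inl (adj τ s :: m)) y ∧ Apart τ c (.inl (adj τ s :: m)) (.inr s) ∧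
      Apart τ c y (.inr s) := by
  obtain ⟨c, h1, h2, h3⟩ := med1 m
  have hpr : pr τ (adj τ s) y = .inr true := by
    rcases hy with hy | rfl
    · exact pr_of_fs_ne hy
    · simp
  refine ⟨adj τ s :: c, Apart.cons pr_inl pr_inl ?_, Apart.cons pr_inl pr_inl ?_,
    Apart.cons pr_inl pr_inl ?_⟩
  · simpa [ch_adj hτ, hpr] using h2
  · simpa [ch_adj hτ, hpr] using h1
  · simpa [ch_adj hτ, hpr] using h3.symm

lemma med2 (m : W k) : ∀ (τ : Ty) (m' : W k) (s : Bool), τ ≠ .O →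
    ∃ c : W k, Apart τ c (.inl m) (.inl m') ∧ Apart τ c (.inl m) (.inr s) ∧
      Apart τ c (.inl m') (.inr s) := by
  induction m with
  | nil =>
    intro τ m' s hτ
    cases m' with
    | nil => exact ⟨[], by simp [Apart], by simp [Apart], by simp [Apart]⟩
    | cons b m' =>
      by_cases hb : b = adj τ s
      · subst hb
        obtain ⟨c, h1, h2, h3⟩ := med_adj hτ s m' (.inl []) (Or.inr rfl)
        exact ⟨c, h1.symm, h3, h2⟩
      · exact ⟨[], by simp [Apart], by simp [Apart], by simp [Apart, hb]⟩
  | cons a m ih =>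
    intro τ m' s hτ
    cases m' with
    | nil =>
      by_cases hb : a = adj τ s
      · subst hb
        exact med_adj hτ s m (.inl []) (Or.inr rfl)
      · exact ⟨[], by simp [Apart], by simp [Apart, hb], by simp [Apart]⟩
    | cons b m' =>
      by_cases hab : a = b
      · subst hab
        by_cases hs : adj τ s = a
        · obtain ⟨c, h1, h2, h3⟩ := ih (ch τ a) m' false (ch_ne_O _ _)
          exact ⟨a :: c, Apart.cons pr_inl pr_inl (by simpa using h1),
            Apart.cons pr_inl pr_inl (by simpa [hs] using h2),
            Apart.cons pr_inl pr_inl (by simpa [hs] using h3)⟩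
        · obtain ⟨c, h1, h2, h3⟩ := ih (ch τ a) m' true (ch_ne_O _ _)
          exact ⟨a :: c, Apart.cons pr_inl pr_inl (by simpa using h1),
            Apart.cons pr_inl pr_inl (by simpa [hs] using h2),
            Apart.cons pr_inl pr_inl (by simpa [hs] using h3)⟩
      · by_cases ha : a = adj τ s
        · subst ha
          exact med_adj hτ s m (.inl (b :: m')) (Or.inl (by simpa using Ne.symm hab))
        · by_cases hb : b = adj τ s
          · subst hb
            obtain ⟨c, h1, h2, h3⟩ := med_adj hτ s m' (.inl (a :: m)) (Or.inl (by simpa using hab))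
            exact ⟨c, h1.symm, h3, h2⟩
          · exact ⟨[], by simp [Apart, hab], by simp [Apart, ha], by simp [Apart, hb]⟩

/-- two words in the child `a`, the third point not. -/
lemma med_pair (τ : Ty) (a : Lt k) (m m' : W k) (y : Pt k) (hy : pr τ a y = .inr true) :
    ∃ c : W k, Apart τ c (.inl (a :: m)) (.inl (a :: m')) ∧ Apart τ c (.inl (a :: m)) y ∧
      Apart τ c (.inl (a :: m')) y := by
  obtain ⟨c, h1, h2, h3⟩ := med2 m (ch τ a) m' true (ch_ne_O _ _)
  exact ⟨a :: c, Apart.cons pr_inl pr_inl (by simpa using h1),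
    Apart.cons pr_inl pr_inl (by simpa [hy] using h2),
    Apart.cons pr_inl pr_inl (by simpa [hy] using h3)⟩

/-- Axiom A4: medians. -/
lemma dir_med (m : W k) : ∀ (τ : Ty) (m' m'' : W k),
    ∃ c : W k, Apart τ c (.inl m) (.inl m') ∧ Apart τ c (.inl m) (.inl m'') ∧
      Apart τ c (.inl m') (.inl m'') := by
  induction m with
  | nil =>
    intro τ m' m''
    rcases m' with _ | ⟨b, m'⟩
    · exact ⟨[], by simp [Apart], by simp [Apart], by simp [Apart]⟩
    rcases m'' with _ | ⟨d, m''⟩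
    · exact ⟨[], by simp [Apart], by simp [Apart], by simp [Apart]⟩
    by_cases hbd : b = d
    · subst hbd
      obtain ⟨c, h1, h2, h3⟩ := med_pair τ b m' m'' (.inl []) rfl
      exact ⟨c, h2.symm, h3.symm, h1⟩
    · exact ⟨[], by simp [Apart], by simp [Apart], by simp [Apart, hbd]⟩
  | cons a m ih =>
    intro τ m' m''
    rcases m' with _ | ⟨b, m'⟩
    · rcases m'' with _ | ⟨d, m''⟩
      · exact ⟨[], by simp [Apart], by simp [Apart], by simp [Apart]⟩
      by_cases hbd : a = d
      · subst hbd
        obtain ⟨c, h1, h2, h3⟩ := med_pair τ a m m'' (.inl []) rfl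
        exact ⟨c, h2, h1, h3.symm⟩
      · exact ⟨[], by simp [Apart], by simp [Apart, hbd], by simp [Apart]⟩
    by_cases hab : a = b
    · subst hab
      by_cases hd : ∃ v, m'' = a :: v
      · obtain ⟨v, rfl⟩ := hd
        obtain ⟨c, h1, h2, h3⟩ := ih (ch τ a) m' v
        exact ⟨a :: c, Apart.cons pr_inl pr_inl (by simpa using h1),
          Apart.cons pr_inl pr_inl (by simpa using h2),
          Apart.cons pr_inl pr_inl (by simpa using h3)⟩
      · refine med_pair τ a m m' (.inl m'') ?_
        rcases m'' with _ | ⟨d, m''⟩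
        · rfl
        · have : d ≠ a := by rintro rfl; exact hd ⟨_, rfl⟩
          simp [this]
    · rcases m'' with _ | ⟨d, m''⟩
      · exact ⟨[], by simp [Apart, hab], by simp [Apart], by simp [Apart]⟩
      by_cases had : a = d
      · subst had
        obtain ⟨c, h1, h2, h3⟩ := med_pair τ a m m'' (.inl (b :: m')) (by simp [Ne.symm hab])
        exact ⟨c, h2, h1, h3.symm⟩
      by_cases hbd : b = d
      · subst hbd
        obtain ⟨c, h1, h2, h3⟩ := med_pair τ b m' m'' (.inl (a :: m)) (by simp [hab])
        exact ⟨c, h2.symm, h3.symm, h1⟩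
      · exact ⟨[], by simp [Apart, hab], by simp [Apart, had], by simp [Apart, hbd]⟩

end Waz

namespace Waz
open Lt
variable {k : ℕ}

/-- Direction at the branch point `m` towards the branch point `x`. -/
def dO (m x : W k) : Lt k := dir .O m (.inl x)

lemma dO_sep {m m' x : W k} (h1 : x ≠ m) (h2 : x ≠ m') (h3 : m ≠ m') (h4 : dO m x ≠ dO m m') :
    dO m' x = dO m' m :=
  dir_sep m .O m' (.inl x) (by simpa using h1) (by simpa using h2) h3 h4

/-- Version without the `x ≠ m'` hypothesis made explicit. -/
lemma dO_sep' {m m' x : W k} (h1 : x ≠ m) (h3 : m ≠ m') (h4 : dO m x ≠ dO m m') :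
    dO m' x = dO m' m :=
  dO_sep h1 (by rintro rfl; exact h4 rfl) h3 h4

lemma dO_append (m : W k) (a : Lt k) (w : W k) : dO m (m ++ a :: w) = a := dir_append _ _ _ _

lemma dO_dense {m m' : W k} (hm : m ≠ m') : ∃ x, x ≠ m ∧ x ≠ m' ∧ dO x m ≠ dO x m' :=
  dir_dense m .O m' hm

lemma dO_med (m m' m'' : W k) : ∃ c, (m = c ∨ m' = c ∨ dO c m ≠ dO c m') ∧
    (m = c ∨ m'' = c ∨ dO c m ≠ dO c m'') ∧ (m' = c ∨ m'' = c ∨ dO c m' ≠ dO c m'') := by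
  obtain ⟨c, h1, h2, h3⟩ := dir_med m .O m' m''
  exact ⟨c, by simpa [Apart, dO] using h1, by simpa [Apart, dO] using h2,
    by simpa [Apart, dO] using h3⟩

/-- The condition for a function to be a point of the dendrite. -/
def IsPt (f : W k → Option (Lt k)) : Prop :=
  (∀ m m', m ≠ m' → f m ≠ some (dO m m') → f m' = some (dO m' m)) ∧
  (∀ m a, f m = some a → ∃ m', m' ≠ m ∧ f m' ≠ some (dO m' m))

structure XX (k : ℕ) : Type where
  /-- direction at a branch point -/
  fn : W k → Option (Lt k)
  pt : IsPt fn

instance : CoeFun (XX k) (fun _ => W k → Option (Lt k)) := ⟨XX.fn⟩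

@[ext] lemma XX.ext {f g : XX k} (hh : ∀ m, f m = g m) : f = g := by
  cases f; cases g; congr; exact funext hh

lemma XX.c1 (f : XX k) {m m' : W k} (hm : m ≠ m') (hf : f m ≠ some (dO m m')) :
    f m' = some (dO m' m) := f.pt.1 m m' hm hf

lemma XX.c2 (f : XX k) {m : W k} {a : Lt k} (hf : f m = some a) :
    ∃ m', m' ≠ m ∧ f m' ≠ some (dO m' m) := f.pt.2 m a hf

/-- Branch points. -/
def io (m : W k) : XX k := ⟨fun m' => if m' = m then none else some (dO m' m), by
  constructor
  · intro a b hab h1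
    by_cases ha : a = m
    · subst ha; simp [hab.symm]
    · by_cases hb : b = m
      · subst hb; simp [ha] at h1
      · simp only [ha, hb, if_false] at h1 ⊢
        have h1' : dO a m ≠ dO a b := fun h => h1 (by rw [h])
        rw [dO_sep (Ne.symm ha) (Ne.symm hb) hab h1']
  · intro a b hab
    have : a ≠ m := by rintro rfl; simp at hab
    exact ⟨m, this.symm, by simp⟩⟩

@[simp] lemma io_self (m : W k) : io m m = none := by simp [io]
lemma io_ne {m m' : W k} (hm : m' ≠ m) : io m m' = some (dO m' m) := by simp [io, hm]

lemma eq_io {f : XX k} {m : W k} (hf : f m = none) : f = io m := by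
  ext m' : 1
  by_cases hm : m' = m
  · subst hm; simp [hf]
  · rw [io_ne hm]; exact f.c1 (Ne.symm hm) (by simp [hf])

lemma eq_none_iff {f : XX k} {m : W k} : f m = none ↔ f = io m :=
  ⟨eq_io, by rintro rfl; simp⟩

lemma io_injective : Function.Injective (io : W k → XX k) := by
  intro m m' hm
  by_contra hne
  have := io_self m
  rw [hm, io_ne hne] at this
  simp at this

lemma strict_sep {x y : XX k} (hxy : x ≠ y) :
    ∃ m i j, i ≠ j ∧ x m = some i ∧ y m = some j := by
  have aux : ∀ {x y : XX k} {m : W k} {i : Lt k}, x m = none → y m = some i →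
      ∃ m i j, i ≠ j ∧ x m = some i ∧ y m = some j := by
    intro x y m i hx hy
    have hx' := eq_io hx
    obtain ⟨m', h1, h2⟩ := y.c2 hy
    cases hj : y m' with
    | some j =>
      refine ⟨m', dO m' m, j, ?_, by rw [hx', io_ne h1], hj⟩
      rintro rfl; exact h2 hj
    | none =>
      obtain ⟨z, hz1, hz2, hz3⟩ := dO_dense h1
      exact ⟨z, dO z m, dO z m', hz3.symm, by rw [hx', io_ne hz2], by rw [eq_io hj, io_ne hz1]⟩
  obtain ⟨m, hm⟩ : ∃ m, x m ≠ y m := by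
    by_contra hcon
    push Not at hcon
    exact hxy (XX.ext hcon)
  cases hx : x m with
  | none =>
    cases hy : y m with
    | none => rw [hx, hy] at hm; exact absurd rfl hm
    | some j => exact aux hx hy
  | some i =>
    cases hy : y m with
    | none =>
      obtain ⟨m, i, j, h1, h2, h3⟩ := aux hy hx
      exact ⟨m, j, i, h1.symm, h3, h2⟩
    | some j => exact ⟨m, i, j, by rintro rfl; rw [hx, hy] at hm; exact hm rfl, hx, hy⟩

/-- Basic open sets. -/
def UU (m : W k) (a : Lt k) : Set (XX k) := {f | f m = some a}

instance : TopologicalSpace (XX k) :=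
  TopologicalSpace.generateFrom (Set.range fun z : W k × Lt k => UU z.1 z.2)

lemma isOpen_UU (m : W k) (a : Lt k) : IsOpen (UU m a) :=
  TopologicalSpace.isOpen_generateFrom_of_mem ⟨(m, a), rfl⟩

lemma UU_disj {m : W k} {a b : Lt k} (hab : a ≠ b) : Disjoint (UU m a) (UU m b) := by
  rw [Set.disjoint_left]
  intro f hf hf'
  simp only [UU, Set.mem_ofPred_eq] at hf hf'
  rw [hf] at hf'
  exact hab (Option.some.inj hf')

instance : T2Space (XX k) := ⟨by
  intro x y hxy
  obtain ⟨m, i, j, hij, hx, hy⟩ := strict_sep hxy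
  exact ⟨UU m i, UU m j, isOpen_UU _ _, isOpen_UU _ _, hx, hy, UU_disj hij⟩⟩

/-- Letters as options. -/
def ltEquiv (k : ℕ) : Lt k ≃ Option (Option (Fin k)) where
  toFun | .p => none | .q => some none | .h j => some (some j)
  invFun | none => .p | some none => .q | some (some j) => .h j
  left_inv x := by cases x <;> rfl
  right_inv x := by rcases x with _ | _ | _ <;> rfl

instance : Fintype (Lt k) := Fintype.ofEquiv _ (ltEquiv k).symm

lemma card_Lt : Fintype.card (Lt k) = k + 2 := by
  rw [Fintype.card_congr (ltEquiv k)]; simp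

instance : SecondCountableTopology (XX k) :=
  ⟨⟨_, Set.countable_range _, rfl⟩⟩

instance : TopologicalSpace (Lt k) := ⊥
instance : DiscreteTopology (Lt k) := ⟨rfl⟩

/-- The compact cover of the dendrite. -/
structure YY (k : ℕ) : Type where
  /-- direction at a branch point -/
  fn : W k → Lt k
  pt : ∀ m m', m ≠ m' → fn m = dO m m' ∨ fn m' = dO m' m

instance : CoeFun (YY k) (fun _ => W k → Lt k) := ⟨YY.fn⟩

@[ext] lemma YY.ext {f g : YY k} (hh : ∀ m, f m = g m) : f = g := by
  cases f; cases g; congr; exact funext hh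

instance : TopologicalSpace (YY k) := TopologicalSpace.induced YY.fn inferInstance

lemma YY_ind : Topology.IsInducing (YY.fn : YY k → W k → Lt k) := ⟨rfl⟩

lemma YY_continuous (m : W k) : Continuous (fun g : YY k => g m) :=
  (continuous_apply m).comp YY_ind.continuous

instance : CompactSpace (YY k) := by
  have : IsClosed {g : W k → Lt k | ∀ m m', m ≠ m' → g m = dO m m' ∨ g m' = dO m' m} := by
    simp only [Set.ofPred_forall]
    refine isClosed_iInter fun m => isClosed_iInter fun m' => isClosed_iInter fun _ => ?_
    have h1 : IsClosed {g : W k → Lt k | g m = dO m m'} :=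
      isClosed_eq (continuous_apply m) continuous_const
    have h2 : IsClosed {g : W k → Lt k | g m' = dO m' m} :=
      isClosed_eq (continuous_apply m') continuous_const
    exact h1.union h2
  refine ⟨YY_ind.isCompact_iff.mpr ?_⟩
  convert this.isCompact using 1
  ext g
  simp only [Set.image_univ, Set.mem_range]
  exact ⟨fun ⟨y, hy⟩ => hy ▸ y.pt, fun hg => ⟨⟨g, hg⟩, rfl⟩⟩

instance : T2Space (YY k) :=
  Topology.IsEmbedding.t2Space ⟨YY_ind, fun _ _ hh => YY.ext (congrFun hh)⟩

open Classical in
/-- The quotient map. -/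
noncomputable def qq (g : YY k) : XX k :=
  ⟨fun m => if ∀ m', m' ≠ m → g m' = dO m' m then none else some (g m), by
  constructor
  · intro m m' hm h1
    beta_reduce at *
    by_cases hA : ∀ m', m' ≠ m → g m' = dO m' m
    · have hB : ¬ ∀ m'', m'' ≠ m' → g m'' = dO m'' m' := by
        intro hB
        obtain ⟨z, hz1, hz2, hz3⟩ := dO_dense hm
        exact hz3 (by rw [← hA z hz1, ← hB z hz2])
      rw [if_neg hB, hA _ hm.symm]
    · rw [if_neg hA] at h1
      have h1' : g m ≠ dO m m' := fun h => h1 (by rw [h])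
      have h2 := (g.pt m m' hm).resolve_left h1'
      rw [if_neg, h2]
      intro hB
      exact h1' (hB m hm)
  · intro m a hma
    beta_reduce at *
    by_cases hA : ∀ m', m' ≠ m → g m' = dO m' m
    · rw [if_pos hA] at hma; simp at hma
    · push Not at hA
      obtain ⟨m', h1, h2⟩ := hA
      refine ⟨m', h1, ?_⟩
      split_ifs
      · simp
      · simpa using h2⟩

lemma qq_none {g : YY k} {m : W k} (hg : ∀ m', m' ≠ m → g m' = dO m' m) : qq g m = none := by
  simp only [qq]; rw [if_pos hg]

lemma qq_some {g : YY k} {m : W k} (hg : ∃ m', m' ≠ m ∧ g m' ≠ dO m' m) :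
    qq g m = some (g m) := by
  simp only [qq]; rw [if_neg]; push Not; exact hg

lemma qq_eq_some_iff {g : YY k} {m : W k} {a : Lt k} :
    qq g m = some a ↔ g m = a ∧ ∃ m', m' ≠ m ∧ g m' ≠ dO m' m := by
  by_cases hg : ∃ m', m' ≠ m ∧ g m' ≠ dO m' m
  · rw [qq_some hg]; simp [hg]
  · simp only [hg, and_false, iff_false]
    push Not at hg
    rw [qq_none hg]; simp

lemma qq_or (g : YY k) (m : W k) : qq g m = some (g m) ∨ qq g m = none := by
  by_cases hg : ∃ m', m' ≠ m ∧ g m' ≠ dO m' m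
  · exact Or.inl (qq_some hg)
  · push Not at hg; exact Or.inr (qq_none hg)

lemma qq_continuous : Continuous (qq : YY k → XX k) := by
  refine continuous_generateFrom_iff.mpr ?_
  rintro _ ⟨⟨m, a⟩, rfl⟩
  have : qq ⁻¹' (UU m a) = {g : YY k | g m = a} ∩ ⋃ m' : W k, ⋃ _ : m' ≠ m,
      {g : YY k | g m' ≠ dO m' m} := by
    ext g
    simp only [UU, Set.mem_preimage, Set.mem_ofPred_eq, qq_eq_some_iff, Set.mem_inter_iff,
      Set.mem_iUnion, exists_prop]
  rw [this]
  refine IsOpen.inter ?_ (isOpen_iUnion fun m' => isOpen_iUnion fun _ => ?_)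
  · exact (isOpen_discrete {a}).preimage (YY_continuous m)
  · exact (isOpen_discrete {dO m' m}ᶜ).preimage (YY_continuous m')

def germ (m : W k) (a : Lt k) : YY k := ⟨fun m' => if m' = m then a else dO m' m, by
  intro u v huv
  by_cases hu : u = m
  · subst hu; simp [huv.symm]
  · by_cases hv : v = m
    · subst hv; simp [hu]
    · simp only [hu, hv, if_false]
      by_cases h1 : dO u m = dO u v
      · exact Or.inl h1
      · exact Or.inr (dO_sep (Ne.symm hu) (Ne.symm hv) huv h1)⟩

@[simp] lemma germ_self (m : W k) (a : Lt k) : germ m a m = a := by simp [germ]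
lemma germ_ne {m m' : W k} (a : Lt k) (hm : m' ≠ m) : germ m a m' = dO m' m := by simp [germ, hm]

lemma qq_germ (m : W k) (a : Lt k) : qq (germ m a) = io m :=
  eq_io (qq_none fun _ hm => germ_ne a hm)

/-- A lift of a point. -/
def lft (f : XX k) (a : W k → Lt k) : YY k := ⟨fun m => (f m).getD (a m), by
  intro m m' hm
  by_cases h1 : f m = some (dO m m')
  · left; rw [h1]; rfl
  · right; rw [f.c1 hm h1]; rfl⟩

lemma lft_apply (f : XX k) (a : W k → Lt k) (m : W k) : lft f a m = (f m).getD (a m) := rfl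

lemma qq_lft (f : XX k) (a : W k → Lt k) : qq (lft f a) = f := by
  ext m : 1
  cases hm : f m with
  | none =>
    refine qq_none fun m' hm' => ?_
    rw [lft_apply, eq_io hm, io_ne hm']; rfl
  | some i =>
    rw [qq_eq_some_iff]
    refine ⟨by rw [lft_apply, hm]; rfl, ?_⟩
    obtain ⟨m', h1, h2⟩ := f.c2 hm
    cases hj : f m' with
    | some j =>
      refine ⟨m', h1, ?_⟩
      rw [lft_apply, hj]
      rintro rfl
      exact h2 hj
    | none =>
      obtain ⟨z, hz1, hz2, hz3⟩ := dO_dense h1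
      refine ⟨z, hz2, ?_⟩
      rw [lft_apply, eq_io hj, io_ne hz1]
      exact hz3

lemma qq_surjective : Function.Surjective (qq : YY k → XX k) :=
  fun f => ⟨lft f fun _ => p, qq_lft f _⟩

instance : CompactSpace (XX k) := by
  refine ⟨?_⟩
  rw [← Set.image_univ_of_surjective (qq_surjective (k := k))]
  exact isCompact_univ.image qq_continuous

instance : TopologicalSpace.MetrizableSpace (XX k) := inferInstance

end Waz

namespace Waz
open Lt
variable {k : ℕ}

/-- Closed cells. -/
def KK (F : Finset (W k)) (a : W k → Lt k) : Set (XX k) :=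
  {f | ∀ m ∈ F, f m = some (a m) ∨ f m = none}

lemma KK_eq (F : Finset (W k)) (a : W k → Lt k) :
    KK F a = qq '' {g : YY k | ∀ m ∈ F, g m = a m} := by
  ext f
  constructor
  · intro hf
    refine ⟨lft f a, fun m hm => ?_, qq_lft f a⟩
    rcases hf m hm with h1 | h1 <;> rw [lft_apply, h1] <;> rfl
  · rintro ⟨g, hg, rfl⟩ m hm
    rw [← hg m hm]
    exact qq_or g m

lemma KK_preconnected (F : Finset (W k)) (a : W k → Lt k) : IsPreconnected (KK F a) := by
  classical
  rw [isPreconnected_closed_iff]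
  intro t t' ht ht' hsub hne hne'
  by_contra hcon
  have hcon' : ∀ f ∈ KK F a, f ∈ t → f ∈ t' → False := fun f h1 h2 h3 => hcon ⟨f, h1, h2, h3⟩
  have hq : ∀ g : YY k, (∀ m ∈ F, g m = a m) → qq g ∈ KK F a := by
    intro g hg; rw [KK_eq]; exact ⟨g, hg, rfl⟩
  -- pairs agreeing on larger and larger sets
  have key : ∀ F' : Finset (W k), ∃ g g' : YY k, (∀ m ∈ F, g m = a m) ∧ (∀ m ∈ F, g' m = a m) ∧
      qq g ∈ t ∧ qq g' ∈ t' ∧ ∀ m ∈ F', g m = g' m := by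
    intro F'
    induction F' using Finset.induction_on with
    | empty =>
      obtain ⟨f, hf, hft⟩ := hne
      obtain ⟨f', hf', hft'⟩ := hne'
      rw [KK_eq] at hf hf'
      obtain ⟨g, hg, rfl⟩ := hf
      obtain ⟨g', hg', rfl⟩ := hf'
      exact ⟨g, g', hg, hg', hft, hft', by simp⟩
    | insert m F' hm ih =>
      obtain ⟨g, g', hg, hg', hgt, hgt', hag⟩ := ih
      by_cases hmm : g m = g' m
      · refine ⟨g, g', hg, hg', hgt, hgt', fun m' hm' => ?_⟩
        rcases Finset.mem_insert.mp hm' with rfl | h2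
        · exact hmm
        · exact hag m' h2
      · have hmF : m ∉ F := fun h => hmm (by rw [hg m h, hg' m h])
        have step : ∀ m', m' ≠ m → g m' = g' m' → g m' = dO m' m := by
          intro m' hm' he
          rcases g.pt m m' hm'.symm with h1 | h1
          · rcases g'.pt m m' hm'.symm with h2 | h2
            · exact absurd (h1.trans h2.symm) hmm
            · rw [he, h2]
          · exact h1
        have hF : ∀ m' ∈ F, a m' = dO m' m := by
          intro m' h1
          rw [← hg m' h1]
          exact step m' (by rintro rfl; exact hmF h1) (by rw [hg m' h1, hg' m' h1])
        have hgerm : ∀ i, ∀ m' ∈ F, germ m i m' = a m' := by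
          intro i m' h1
          rw [germ_ne i (by rintro rfl; exact hmF h1), hF m' h1]
        have hio : io m ∈ KK F a := by rw [← qq_germ m p]; exact hq _ (hgerm p)
        rcases hsub hio with h1 | h1
        · refine ⟨germ m (g' m), g', hgerm _, hg', by rw [qq_germ]; exact h1, hgt', ?_⟩
          intro m' hm'
          rcases Finset.mem_insert.mp hm' with rfl | h2
          · simp
          · have hne2 : m' ≠ m := by rintro rfl; exact hm h2
            rw [germ_ne _ hne2, ← hag m' h2, step m' hne2 (hag m' h2)]
        · refine ⟨g, germ m (g m), hg, hgerm _, hgt, by rw [qq_germ]; exact h1, ?_⟩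
          intro m' hm'
          rcases Finset.mem_insert.mp hm' with rfl | h2
          · simp
          · have hne2 : m' ≠ m := by rintro rfl; exact hm h2
            rw [germ_ne _ hne2, step m' hne2 (hag m' h2)]
  let Z : Finset (W k) → Set (YY k × YY k) := fun F' =>
    {z | (∀ m ∈ F, z.1 m = a m) ∧ (∀ m ∈ F, z.2 m = a m) ∧
      qq z.1 ∈ t ∧ qq z.2 ∈ t' ∧ ∀ m ∈ F', z.1 m = z.2 m}
  have hZc : ∀ F', IsClosed (Z F') := by
    intro F'
    have e1 : ∀ m, Continuous (fun z : YY k × YY k => z.1 m) :=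
      fun m => (YY_continuous m).comp continuous_fst
    have e2 : ∀ m, Continuous (fun z : YY k × YY k => z.2 m) :=
      fun m => (YY_continuous m).comp continuous_snd
    have c1 : IsClosed {z : YY k × YY k | ∀ m ∈ F, z.1 m = a m} := by
      simp only [Set.ofPred_forall]
      exact isClosed_iInter fun m => isClosed_iInter fun _ => isClosed_eq (e1 m) continuous_const
    have c2 : IsClosed {z : YY k × YY k | ∀ m ∈ F, z.2 m = a m} := by
      simp only [Set.ofPred_forall]
      exact isClosed_iInter fun m => isClosed_iInter fun _ => isClosed_eq (e2 m) continuous_const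
    have c3 : IsClosed {z : YY k × YY k | ∀ m ∈ F', z.1 m = z.2 m} := by
      simp only [Set.ofPred_forall]
      exact isClosed_iInter fun m => isClosed_iInter fun _ => isClosed_eq (e1 m) (e2 m)
    have c4 : IsClosed {z : YY k × YY k | qq z.1 ∈ t} :=
      ht.preimage (qq_continuous.comp continuous_fst)
    have c5 : IsClosed {z : YY k × YY k | qq z.2 ∈ t'} :=
      ht'.preimage (qq_continuous.comp continuous_snd)
    exact c1.inter (c2.inter (c4.inter (c5.inter c3)))
  have hdir : Directed (· ⊇ ·) Z := by
    intro F1 F2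
    refine ⟨F1 ∪ F2, ?_, ?_⟩
    · rintro z ⟨h1, h2, h3, h4, h5⟩
      exact ⟨h1, h2, h3, h4, fun m hm => h5 m (Finset.mem_union_left _ hm)⟩
    · rintro z ⟨h1, h2, h3, h4, h5⟩
      exact ⟨h1, h2, h3, h4, fun m hm => h5 m (Finset.mem_union_right _ hm)⟩
  obtain ⟨z, hz⟩ := IsCompact.nonempty_iInter_of_directed_nonempty_isCompact_isClosed Z hdir
    (fun F' => by obtain ⟨g, g', hh⟩ := key F'; exact ⟨(g, g'), hh⟩)
    (fun F' => (hZc F').isCompact) hZc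
  rw [Set.mem_iInter] at hz
  have he : z.1 = z.2 := YY.ext fun m => (hz {m}).2.2.2.2 m (by simp)
  obtain ⟨h1, h2, h3, h4, -⟩ := hz ∅
  exact hcon' _ (hq _ h1) h3 (he ▸ h4)

instance : ConnectedSpace (XX k) := by
  have h1 : KK (∅ : Finset (W k)) (fun _ => p) = Set.univ := by
    ext f; simp [KK]
  have h2 : PreconnectedSpace (XX k) := ⟨h1 ▸ KK_preconnected _ _⟩
  exact { toNonempty := ⟨io []⟩ }

lemma aux_ne {x : XX k} {m m1 c : W k} (hm1 : x m1 ≠ some (dO m1 m))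
    (hc : c ≠ m) (h : m = c ∨ m1 = c ∨ dO c m ≠ dO c m1) : x c ≠ some (dO c m) := by
  rcases h with h | h | h
  · exact absurd h.symm hc
  · exact h ▸ hm1
  · by_cases h0 : m1 = c
    · exact h0 ▸ hm1
    · have h1 : dO m1 m = dO m1 c := dO_sep' hc.symm (Ne.symm h0) h
      rw [h1] at hm1
      rw [x.c1 h0 hm1]
      intro h2
      exact h (Option.some.inj h2).symm

lemma pair_lemma {x y : XX k} {m : W k} {a : Lt k} (hx : x m = some a) (hy : y m = some a) :
    ∃ m' j, m' ≠ m ∧ x m' = some j ∧ y m' = some j ∧ j ≠ dO m' m ∧ dO m m' = a := by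
  obtain ⟨m1, hm1, hx1⟩ := x.c2 hx
  obtain ⟨m2, hm2, hy1⟩ := y.c2 hy
  have hd1 : dO m m1 = a := by
    have := x.c1 hm1 hx1; rw [hx] at this; exact (Option.some.inj this).symm
  have hd2 : dO m m2 = a := by
    have := y.c1 hm2 hy1; rw [hy] at this; exact (Option.some.inj this).symm
  obtain ⟨c, h1, h2, h3⟩ := dO_med m m1 m2
  have hc : c ≠ m := by
    rintro rfl
    rcases h3 with h3 | h3 | h3
    · exact hm1 h3
    · exact hm2 h3
    · exact h3 (hd1.trans hd2.symm)
  have hxc := aux_ne hx1 hc h1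
  have hyc := aux_ne hy1 hc h2
  obtain ⟨m', hm', hm'c, hd⟩ := dO_dense hc.symm
  have e1 : dO c m = dO c m' := dO_sep hm'.symm hc.symm hm'c hd
  rw [e1] at hxc hyc
  refine ⟨m', dO m' c, hm', x.c1 hm'c.symm hxc, y.c1 hm'c.symm hyc, hd.symm, ?_⟩
  have e2 : dO m c = dO m m' := dO_sep hm'c.symm hc hm' hd.symm
  rw [← e2, ← hd1]
  rcases h1 with h | h | h
  · exact absurd h.symm hc
  · rw [h]
  · by_cases h0 : m1 = c
    · rw [h0]
    · exact (dO_sep (Ne.symm (Ne.symm h0)) hm1 hc h.symm).symm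

lemma mem_UU_of {f : XX k} {m m' : W k} {j : Lt k} (hm : m' ≠ m) (hj : j ≠ dO m' m)
    (hf : f m' = some j ∨ f m' = none) : f m = some (dO m m') := by
  refine f.c1 hm ?_
  rcases hf with hf | hf <;> rw [hf]
  · simpa using hj
  · simp

lemma sInter_preconnected (T : Set (Set (XX k))) (hT : T.Finite)
    (hsub : T ⊆ Set.range fun z : W k × Lt k => UU z.1 z.2) : IsPreconnected (⋂₀ T) := by
  classical
  refine isPreconnected_of_forall_pair fun x hx y hy => ?_
  have hch : ∀ U : Set (XX k), ∃ m' : W k, U ∈ T → ∃ j, x m' = some j ∧ y m' = some j ∧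
      ∀ f : XX k, f m' = some j ∨ f m' = none → f ∈ U := by
    intro U
    by_cases hU : U ∈ T
    · obtain ⟨⟨m, a⟩, rfl⟩ := hsub hU
      obtain ⟨m', j, h1, h2, h3, h4, h5⟩ := pair_lemma (hx _ hU) (hy _ hU)
      refine ⟨m', fun _ => ⟨j, h2, h3, fun f hf => ?_⟩⟩
      have := mem_UU_of h1 h4 hf
      rw [h5] at this
      exact this
    · exact ⟨[], fun h => absurd h hU⟩
  choose mm hmm using hch
  refine ⟨KK (hT.toFinset.image mm) (fun m => (x m).getD p), ?_, ?_, ?_, KK_preconnected _ _⟩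
  · intro f hf U hU
    obtain ⟨j, h1, h2, h3⟩ := hmm U hU
    apply h3
    have := hf (mm U) (Finset.mem_image_of_mem _ (hT.mem_toFinset.mpr hU))
    simpa [h1] using this
  · intro m hm
    obtain ⟨U, hU, rfl⟩ := Finset.mem_image.mp hm
    obtain ⟨j, h1, h2, h3⟩ := hmm U (hT.mem_toFinset.mp hU)
    simp [h1]
  · intro m hm
    obtain ⟨U, hU, rfl⟩ := Finset.mem_image.mp hm
    obtain ⟨j, h1, h2, h3⟩ := hmm U (hT.mem_toFinset.mp hU)
    simp [h1, h2]

lemma UU_preconnected (m : W k) (a : Lt k) : IsPreconnected (UU m a) := by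
  have := sInter_preconnected {UU m a} (Set.finite_singleton _)
    (by rintro _ rfl; exact ⟨(m, a), rfl⟩)
  simpa using this

instance : LocallyConnectedSpace (XX k) := by
  have hb := TopologicalSpace.isTopologicalBasis_of_subbasis
    (t := (inferInstance : TopologicalSpace (XX k))) (s := Set.range fun z : W k × Lt k => UU z.1 z.2) rfl
  refine locallyConnectedSpace_of_connected_bases
    (fun _ s => s) (fun x s => s ∈ ((fun f => ⋂₀ f) '' {f : Set (Set (XX k)) | f.Finite ∧ f ⊆
      Set.range fun z : W k × Lt k => UU z.1 z.2}) ∧ x ∈ s) (fun x => hb.nhds_hasBasis) ?_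
  rintro x s ⟨⟨T, ⟨hT1, hT2⟩, rfl⟩, -⟩
  exact sInter_preconnected T hT1 hT2

end Waz

namespace Waz
open Lt
variable {k : ℕ}

lemma compl_io (m : W k) : ({io m}ᶜ : Set (XX k)) = ⋃ a, UU m a := by
  ext f
  simp only [Set.mem_compl_iff, Set.mem_singleton_iff, ← eq_none_iff, Set.mem_iUnion, UU,
    Set.mem_ofPred_eq]
  exact Option.ne_none_iff_exists'

lemma subset_UU {s : Set (XX k)} (hs : IsPreconnected s) {m : W k} (hm : io m ∉ s) {f : XX k}
    (hf : f ∈ s) {a : Lt k} (ha : f m = some a) : s ⊆ UU m a := by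
  have hd : Disjoint (UU m a) (⋃ b, ⋃ _ : b ≠ a, UU m b) := by
    simp only [Set.disjoint_iUnion_right]
    exact fun b hb => UU_disj hb.symm
  refine hs.subset_left_of_subset_union (isOpen_UU m a)
    (isOpen_iUnion fun b => isOpen_iUnion fun _ => isOpen_UU m b) hd ?_ ⟨f, hf, ha⟩
  intro g hg
  cases hgm : g m with
  | none => rw [eq_io hgm] at hg; exact absurd hg hm
  | some b =>
    by_cases hb : b = a
    · subst hb; exact Or.inl hgm
    · right
      simp only [Set.mem_iUnion]
      exact ⟨b, hb, hgm⟩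

lemma component_io {m : W k} {x : XX k} {a : Lt k} (hx : x m = some a) :
    connectedComponentIn ({io m}ᶜ) x = UU m a := by
  have hxm : x ∈ ({io m}ᶜ : Set (XX k)) := by
    rw [compl_io]; exact Set.mem_iUnion.mpr ⟨a, hx⟩
  apply Set.Subset.antisymm
  · refine subset_UU isPreconnected_connectedComponentIn ?_ (mem_connectedComponentIn hxm) hx
    intro h
    exact connectedComponentIn_subset _ _ h rfl
  · refine (UU_preconnected m a).subset_connectedComponentIn hx ?_
    rw [compl_io]; exact Set.subset_iUnion (UU m) a

lemma io_append_mem (m : W k) (a : Lt k) : io (m ++ [a]) ∈ UU m a := by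
  have : m ≠ m ++ [a] := by simp
  simp only [UU, Set.mem_ofPred_eq, io_ne this, dO_append]

lemma UU_inj (m : W k) : Function.Injective (UU m) := by
  intro a b hab
  have := io_append_mem m a
  rw [hab] at this
  have h2 := io_append_mem m a
  simp only [UU, Set.mem_ofPred_eq] at this h2
  rw [h2] at this
  exact Option.some.inj this

lemma ptOrder_io (m : W k) : ptOrder (XX k) (io m) = k + 2 := by
  have : setComponents (XX k) {io m}ᶜ = Set.range (UU m) := by
    ext C
    constructor
    · rintro ⟨x, hx, rfl⟩
      rw [compl_io] at hx
      obtain ⟨a, ha⟩ := Set.mem_iUnion.mp hx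
      exact ⟨a, (component_io ha).symm⟩
    · rintro ⟨a, rfl⟩
      refine ⟨io (m ++ [a]), ?_, (component_io (io_append_mem m a)).symm⟩
      rw [compl_io]; exact Set.mem_iUnion.mpr ⟨a, io_append_mem m a⟩
  rw [ptOrder, this, ← Set.image_univ, Set.ncard_image_of_injective _ (UU_inj m), Set.ncard_univ,
    Nat.card_eq_fintype_card, card_Lt]

lemma exists_ne_Lt (i : Lt k) : ∃ j, j ≠ i := by
  by_cases hi : i = p
  · exact ⟨q, by rw [hi]; simp⟩
  · exact ⟨p, Ne.symm hi⟩

lemma BB_mem_component {x y : XX k} {c : W k} {i : Lt k} (hx : x c = some i) (hy : y c ≠ some i) :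
    y ∈ connectedComponentIn ({x}ᶜ) (io c) := by
  have hpre : ∃ j, j ≠ i ∧ y ∈ KK {c} (fun _ => j) := by
    cases hyc : y c with
    | none =>
      obtain ⟨j, hj⟩ := exists_ne_Lt i
      exact ⟨j, hj, by intro m hm; rw [Finset.mem_singleton.mp hm]; exact Or.inr hyc⟩
    | some j =>
      refine ⟨j, fun h => hy (by rw [hyc, h]), ?_⟩
      intro m hm; rw [Finset.mem_singleton.mp hm]; exact Or.inl hyc
  obtain ⟨j, hj, hyK⟩ := hpre
  have hio : io c ∈ KK {c} (fun _ => j) := by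
    intro m hm; rw [Finset.mem_singleton.mp hm]; simp
  refine (KK_preconnected {c} (fun _ => j)).subset_connectedComponentIn hio ?_ hyK
  intro f hf hfx
  rw [Set.mem_singleton_iff] at hfx
  subst hfx
  rcases hf c (by simp) with h1 | h1
  · rw [hx] at h1; exact hj (Option.some.inj h1).symm
  · rw [hx] at h1; simp at h1

lemma three_points {x : XX k} (hx : ∀ m, x m ≠ none) {y1 y2 y3 : XX k} (h1 : y1 ≠ x) (h2 : y2 ≠ x)
    (h3 : y3 ≠ x) :
    connectedComponentIn ({x}ᶜ) y1 = connectedComponentIn ({x}ᶜ) y2 ∨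
    connectedComponentIn ({x}ᶜ) y1 = connectedComponentIn ({x}ᶜ) y3 ∨
    connectedComponentIn ({x}ᶜ) y2 = connectedComponentIn ({x}ᶜ) y3 := by
  have sep : ∀ {y : XX k}, y ≠ x → ∃ m, y m ≠ x m := by
    intro y hy
    obtain ⟨m, i, j, hij, ha, hb⟩ := strict_sep hy
    exact ⟨m, by rw [ha, hb]; simpa using hij⟩
  obtain ⟨m1, hm1⟩ := sep h1
  obtain ⟨m2, hm2⟩ := sep h2
  obtain ⟨m3, hm3⟩ := sep h3
  obtain ⟨c, a12, a13, a23⟩ := dO_med m1 m2 m3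
  obtain ⟨i, hi⟩ := Option.ne_none_iff_exists'.mp (hx c)
  have key : ∀ {y : XX k} {m : W k}, y m ≠ x m → (m = c ∨ dO c m ≠ i) →
      connectedComponentIn ({x}ᶜ) y = connectedComponentIn ({x}ᶜ) (io c) := by
    intro y m hm hc
    refine (connectedComponentIn_eq (BB_mem_component hi ?_)).symm
    by_cases h0 : m = c
    · subst h0; rw [← hi]; exact hm
    · have hc' := hc.resolve_left h0
      have e1 : x m = some (dO m c) := x.c1 (Ne.symm h0) (by rw [hi]; simpa using hc'.symm)
      rw [e1] at hm
      rw [y.c1 h0 hm]; simpa using hc'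
  by_cases b1 : m1 = c ∨ dO c m1 ≠ i
  · by_cases b2 : m2 = c ∨ dO c m2 ≠ i
    · exact Or.inl ((key hm1 b1).trans (key hm2 b2).symm)
    · by_cases b3 : m3 = c ∨ dO c m3 ≠ i
      · exact Or.inr (Or.inl ((key hm1 b1).trans (key hm3 b3).symm))
      · push Not at b2 b3
        exfalso
        rcases a23 with h | h | h
        · exact b2.1 h
        · exact b3.1 h
        · exact h (b2.2.trans b3.2.symm)
  · by_cases b2 : m2 = c ∨ dO c m2 ≠ i
    · by_cases b3 : m3 = c ∨ dO c m3 ≠ i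
      · exact Or.inr (Or.inr ((key hm2 b2).trans (key hm3 b3).symm))
      · push Not at b1 b3
        exfalso
        rcases a13 with h | h | h
        · exact b1.1 h
        · exact b3.1 h
        · exact h (b1.2.trans b3.2.symm)
    · push Not at b1 b2
      exfalso
      rcases a12 with h | h | h
      · exact b1.1 h
      · exact b2.1 h
      · exact h (b1.2.trans b2.2.symm)

lemma ptOrder_other {x : XX k} (hx : ∀ m, x m ≠ none) :
    ptOrder (XX k) x = 1 ∨ ptOrder (XX k) x = 2 := by
  have hx0 : io [] ≠ x := by rintro rfl; exact hx [] (io_self [])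
  by_cases hall : ∀ y, y ≠ x → connectedComponentIn ({x}ᶜ) y = connectedComponentIn ({x}ᶜ) (io [])
  · left
    have : setComponents (XX k) {x}ᶜ = {connectedComponentIn ({x}ᶜ) (io [])} := by
      ext C
      constructor
      · rintro ⟨y, hy, rfl⟩; exact hall y hy
      · rintro rfl; exact ⟨io [], hx0, rfl⟩
    rw [ptOrder, this, Set.ncard_singleton]
  · right
    push Not at hall
    obtain ⟨z, hz, hzne⟩ := hall
    have : setComponents (XX k) {x}ᶜ =
        {connectedComponentIn ({x}ᶜ) (io []), connectedComponentIn ({x}ᶜ) z} := by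
      ext C
      constructor
      · rintro ⟨y, hy, rfl⟩
        rcases three_points hx hx0 hz hy with h | h | h
        · exact absurd h.symm hzne
        · exact Or.inl h.symm
        · exact Or.inr h.symm
      · rintro (rfl | rfl)
        · exact ⟨io [], hx0, rfl⟩
        · exact ⟨z, hz, rfl⟩
    rw [ptOrder, this, Set.ncard_pair hzne.symm]

lemma ptOrder_eq_iff (hk : 1 ≤ k) (x : XX k) : ptOrder (XX k) x = k + 2 ↔ ∃ m, x = io m := by
  constructor
  · intro hx
    by_contra hcon
    push Not at hcon
    rcases ptOrder_other (x := x) (fun m hm => hcon m (eq_io hm)) with h | h <;> omega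
  · rintro ⟨m, rfl⟩; exact ptOrder_io m

lemma exists_io_mem {A : Set (XX k)} (hA : IsPreconnected A) {x y : XX k} (hx : x ∈ A) (hy : y ∈ A)
    (hxy : x ≠ y) : ∃ m i j, i ≠ j ∧ x m = some i ∧ y m = some j ∧ io m ∈ A := by
  obtain ⟨m, i, j, hij, h1, h2⟩ := strict_sep hxy
  refine ⟨m, i, j, hij, h1, h2, ?_⟩
  by_contra hcon
  have := subset_UU hA hcon hx h1 hy
  simp only [UU, Set.mem_ofPred_eq] at this
  rw [h2] at this
  exact hij (Option.some.inj this).symm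

lemma circle_compl (z : Circle) : IsPreconnected ({z}ᶜ : Set Circle) := by
  obtain ⟨t, rfl⟩ := Circle.exp_surjective z
  have himg : ({Circle.exp t}ᶜ : Set Circle) = Circle.exp '' Set.Ioo t (t + 2 * Real.pi) := by
    ext w
    constructor
    · intro hw
      obtain ⟨s, rfl⟩ := Circle.exp_surjective w
      have h1 := toIcoMod_mem_Ico Real.two_pi_pos t s
      have h2 : Circle.exp (toIcoMod Real.two_pi_pos t s) = Circle.exp s :=
        Circle.exp_eq_exp.mpr ⟨-toIcoDiv Real.two_pi_pos t s, by
          rw [toIcoMod]; push_cast; rw [zsmul_eq_mul]; ring⟩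
      refine ⟨_, ⟨lt_of_le_of_ne h1.1 ?_, h1.2⟩, h2⟩
      intro h3
      apply hw
      rw [Set.mem_singleton_iff, ← h2, ← h3]
    · rintro ⟨s, hs, rfl⟩ h1
      have := Circle.exp_injOn_Ico (a := t) (b := t + 2 * Real.pi) (by simp)
        ⟨hs.1.le, hs.2⟩ ⟨le_refl t, by linarith [Real.two_pi_pos]⟩ h1
      exact hs.1.ne this.symm
  rw [himg]
  exact isPreconnected_Ioo.image _ Circle.exp.continuous.continuousOn

lemma no_circle (S : Set (XX k)) : IsEmpty (S ≃ₜ Circle) := by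
  refine ⟨fun e => ?_⟩
  have hS : IsPreconnected S := by
    have h1 : IsPreconnected (Set.range fun t : ℝ => ((e.symm (Circle.exp t) : S) : XX k)) :=
      isPreconnected_range (continuous_subtype_val.comp
        (e.symm.continuous.comp Circle.exp.continuous))
    convert h1
    ext x
    constructor
    · intro hx
      obtain ⟨t, ht⟩ := Circle.exp_surjective (e ⟨x, hx⟩)
      exact ⟨t, by simp [ht]⟩
    · rintro ⟨t, rfl⟩; exact (e.symm _).2
  have hne : ∃ a b : Circle, a ≠ b := ⟨1, -1, by
    intro h
    have := congrArg (fun z : Circle => (z : ℂ)) h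
    norm_num at this⟩
  obtain ⟨a, b, hab⟩ := hne
  have hab' : ((e.symm a : S) : XX k) ≠ e.symm b := by
    intro h; exact hab (e.symm.injective (Subtype.ext h))
  obtain ⟨m, i, j, hij, h1, h2, h3⟩ := exists_io_mem hS (e.symm a).2 (e.symm b).2 hab'
  have hT : IsPreconnected ((fun z => ((e.symm z : S) : XX k)) '' ({e ⟨io m, h3⟩}ᶜ : Set Circle)) :=
    (circle_compl _).image _ (continuous_subtype_val.comp e.symm.continuous).continuousOn
  have hm : io m ∉ (fun z => ((e.symm z : S) : XX k)) '' ({e ⟨io m, h3⟩}ᶜ : Set Circle) := by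
    rintro ⟨z, hz, hz'⟩
    apply hz
    have : e.symm z = ⟨io m, h3⟩ := Subtype.ext hz'
    rw [Set.mem_singleton_iff, ← this]; simp
  have mem : ∀ z : Circle, ((e.symm z : S) : XX k) m ≠ none →
      ((e.symm z : S) : XX k) ∈ (fun z => ((e.symm z : S) : XX k)) '' ({e ⟨io m, h3⟩}ᶜ : Set Circle) := by
    intro z hz
    refine ⟨z, ?_, rfl⟩
    rintro rfl
    simp at hz
  have := subset_UU hT hm (mem a (by simp [h1])) h1 (mem b (by simp [h2]))
  simp only [UU, Set.mem_ofPred_eq] at this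
  rw [h2] at this
  exact hij (Option.some.inj this).symm

theorem waz (k : ℕ) : IsWazewskiDendrite (k + 2) (XX k) := by
  refine ⟨⟨inferInstance, inferInstance, inferInstance, inferInstance, inferInstance, no_circle⟩,
    ?_, ?_⟩
  · intro x
    by_cases hx : ∃ m, x m = none
    · obtain ⟨m, hm⟩ := hx
      rw [eq_io hm]; exact Or.inr (Or.inr (ptOrder_io m))
    · push Not at hx
      rcases ptOrder_other hx with h | h
      · exact Or.inl h
      · exact Or.inr (Or.inl h)
  · rintro A ⟨e⟩
    have hS : IsPreconnected A := by
      have h1 : IsPreconnected (Set.range fun t : unitInterval => ((e.symm t : A) : XX k)) :=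
        isPreconnected_range (continuous_subtype_val.comp e.symm.continuous)
      convert h1
      ext x
      constructor
      · intro hx
        exact ⟨e ⟨x, hx⟩, by simp⟩
      · rintro ⟨t, rfl⟩; exact (e.symm _).2
    have hab' : ((e.symm 0 : A) : XX k) ≠ e.symm 1 := by
      intro h; exact zero_ne_one (e.symm.injective (Subtype.ext h))
    obtain ⟨m, i, j, -, -, -, h3⟩ := exists_io_mem hS (e.symm 0).2 (e.symm 1).2 hab'
    exact ⟨io m, h3, ptOrder_io m⟩

end Waz

namespace Waz
open Lt
variable {k : ℕ}

/-- Permute the first letter. -/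
def hatf (σ : Equiv.Perm (Lt k)) : W k → W k
  | [] => []
  | a :: w => σ a :: w

@[simp] lemma hatf_nil (σ : Equiv.Perm (Lt k)) : hatf σ [] = [] := rfl
@[simp] lemma hatf_cons (σ : Equiv.Perm (Lt k)) (a : Lt k) (w : W k) :
  hatf σ (a :: w) = σ a :: w := rfl

/-- Rotation about the root. -/
def hat : Equiv.Perm (Lt k) →* Equiv.Perm (W k) where
  toFun σ := ⟨hatf σ, hatf σ⁻¹, fun x => by cases x <;> simp, fun x => by cases x <;> simp⟩
  map_one' := by ext1 x; cases x <;> rfl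
  map_mul' σ ρ := by ext1 x; cases x <;> rfl

@[simp] lemma hat_nil (σ : Equiv.Perm (Lt k)) : hat σ [] = [] := rfl
@[simp] lemma hat_cons (σ : Equiv.Perm (Lt k)) (a : Lt k) (w : W k) :
  hat σ (a :: w) = σ a :: w := rfl

/-- The flip. -/
def sw : Equiv.Perm (Lt k) := Equiv.swap p q
@[simp] lemma sw_p : sw (p : Lt k) = q := Equiv.swap_apply_left _ _
@[simp] lemma sw_q : sw (q : Lt k) = p := Equiv.swap_apply_right _ _
@[simp] lemma sw_h (j : Fin k) : sw (h j : Lt k) = h j :=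
  Equiv.swap_apply_of_ne_of_ne (by simp) (by simp)
@[simp] lemma sw_sw (a : Lt k) : sw (sw a) = a := Equiv.swap_apply_self _ _ _
@[simp] lemma sw_inv : (sw : Equiv.Perm (Lt k))⁻¹ = sw := Equiv.swap_inv _ _
@[simp] lemma sw_mul : (sw : Equiv.Perm (Lt k)) * sw = 1 := Equiv.swap_mul_self _ _

/-- The flip on words. -/
def F : Equiv.Perm (W k) := hat sw
@[simp] lemma F_nil : F ([] : W k) = [] := rfl
@[simp] lemma F_p (w : W k) : F (p :: w) = q :: w := by simp [F]
@[simp] lemma F_q (w : W k) : F (q :: w) = p :: w := by simp [F]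
@[simp] lemma F_h (j : Fin k) (w : W k) : F (h j :: w) = h j :: w := by simp [F]
@[simp] lemma F_F (w : W k) : F (F w) = w := by
  rcases w with _ | ⟨_ | _ | j, w⟩ <;> simp
@[simp] lemma F_inv : (F : Equiv.Perm (W k))⁻¹ = F := by rw [F, ← map_inv]; simp
@[simp] lemma F_eq_nil {w : W k} : F w = [] ↔ w = [] := by
  rcases w with _ | ⟨_ | _ | j, w⟩ <;> simp

/-- Act in the child `a`. -/
def liftf (a : Lt k) (g : W k → W k) : W k → W k
  | [] => []
  | b :: w => if b = a then b :: g w else b :: w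

/-- Act in the child `a`. -/
def lift (a : Lt k) : Equiv.Perm (W k) →* Equiv.Perm (W k) where
  toFun g := ⟨liftf a g, liftf a (g⁻¹ : Equiv.Perm (W k)),
    fun x => by cases x <;> simp only [liftf]; split_ifs <;> simp_all,
    fun x => by cases x <;> simp only [liftf]; split_ifs <;> simp_all⟩
  map_one' := by ext1 x; cases x <;> simp [liftf]
  map_mul' g g' := by
    ext1 x
    cases x
    · rfl
    · simp only [liftf, Equiv.coe_fn_mk, Equiv.Perm.mul_apply]; split_ifs <;> simp_all

@[simp] lemma lift_nil (a : Lt k) (g : Equiv.Perm (W k)) : lift a g [] = [] := rfl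
lemma lift_cons (a b : Lt k) (g : Equiv.Perm (W k)) (w : W k) :
    lift a g (b :: w) = if b = a then b :: g w else b :: w := rfl
@[simp] lemma lift_same (a : Lt k) (g : Equiv.Perm (W k)) (w : W k) :
    lift a g (a :: w) = a :: g w := by simp [lift_cons]
@[simp] lemma lift_ne {a b : Lt k} (hab : b ≠ a) (g : Equiv.Perm (W k)) (w : W k) :
    lift a g (b :: w) = b :: w := by simp [lift_cons, hab]

/-- The element `c`. -/
def cf : W k → W k
  | [] => [q]
  | [.p] => []
  | .p :: .p :: w => p :: w
  | .p :: .q :: w => q :: p :: F w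
  | .p :: .h j :: w => h j :: w
  | .q :: w => q :: q :: w
  | .h j :: w => q :: h j :: w

/-- The inverse of `c`. -/
def cfi : W k → W k
  | [] => [p]
  | .p :: w => p :: p :: w
  | [.q] => []
  | .q :: .p :: w => p :: q :: F w
  | .q :: .q :: w => q :: w
  | .q :: .h j :: w => h j :: w
  | .h j :: w => p :: h j :: w

/-- The element `c`. -/
def cc : Equiv.Perm (W k) where
  toFun := cf
  invFun := cfi
  left_inv x := by rcases x with _ | ⟨_ | _ | j, _ | ⟨_ | _ | j, w⟩⟩ <;> simp [cf, cfi]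
  right_inv x := by rcases x with _ | ⟨_ | _ | j, _ | ⟨_ | _ | j, w⟩⟩ <;> simp [cf, cfi]

@[simp] lemma cc_0 : cc ([] : W k) = [q] := rfl
@[simp] lemma cc_1 : cc ([p] : W k) = [] := rfl
@[simp] lemma cc_2 (w : W k) : cc (p :: p :: w) = p :: w := rfl
@[simp] lemma cc_3 (w : W k) : cc (p :: q :: w) = q :: p :: F w := rfl
@[simp] lemma cc_4 (j : Fin k) (w : W k) : cc (p :: h j :: w) = h j :: w := rfl
@[simp] lemma cc_5 (w : W k) : cc (q :: w) = q :: q :: w := rfl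
@[simp] lemma cc_6 (j : Fin k) (w : W k) : cc (h j :: w) = q :: h j :: w := rfl

/-- The element `x`. -/
def xf : W k → W k
  | [] => [q]
  | [.p] => []
  | .p :: .p :: w => p :: w
  | .p :: .q :: w => q :: q :: F w
  | .p :: .h j :: w => h j :: w
  | .q :: w => q :: p :: w
  | .h j :: w => q :: h j :: w

/-- The inverse of `x`. -/
def xfi : W k → W k
  | [] => [p]
  | .p :: w => p :: p :: w
  | [.q] => []
  | .q :: .q :: w => p :: q :: F w
  | .q :: .p :: w => q :: w
  | .q :: .h j :: w => h j :: w
  | .h j :: w => p :: h j :: w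

/-- The element `x`. -/
def xx : Equiv.Perm (W k) where
  toFun := xf
  invFun := xfi
  left_inv x := by rcases x with _ | ⟨_ | _ | j, _ | ⟨_ | _ | j, w⟩⟩ <;> simp [xf, xfi]
  right_inv x := by rcases x with _ | ⟨_ | _ | j, _ | ⟨_ | _ | j, w⟩⟩ <;> simp [xf, xfi]

@[simp] lemma xx_0 : xx ([] : W k) = [q] := rfl
@[simp] lemma xx_1 : xx ([p] : W k) = [] := rfl
@[simp] lemma xx_2 (w : W k) : xx (p :: p :: w) = p :: w := rfl
@[simp] lemma xx_3 (w : W k) : xx (p :: q :: w) = q :: q :: F w := rfl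
@[simp] lemma xx_4 (j : Fin k) (w : W k) : xx (p :: h j :: w) = h j :: w := rfl
@[simp] lemma xx_5 (w : W k) : xx (q :: w) = q :: p :: w := rfl
@[simp] lemma xx_6 (j : Fin k) (w : W k) : xx (h j :: w) = q :: h j :: w := rfl

/-- The involution `s`. -/
def sf : W k → W k
  | [] => [p]
  | [.p] => []
  | .p :: .p :: w => p :: p :: F w
  | .p :: .q :: w => q :: w
  | .p :: .h j :: w => h j :: w
  | .q :: w => p :: q :: w
  | .h j :: w => p :: h j :: w

/-- The involution `s`. -/
def ss : Equiv.Perm (W k) where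
  toFun := sf
  invFun := sf
  left_inv x := by rcases x with _ | ⟨_ | _ | j, _ | ⟨_ | _ | j, w⟩⟩ <;> simp [sf]
  right_inv x := by rcases x with _ | ⟨_ | _ | j, _ | ⟨_ | _ | j, w⟩⟩ <;> simp [sf]

@[simp] lemma ss_0 : ss ([] : W k) = [p] := rfl
@[simp] lemma ss_1 : ss ([p] : W k) = [] := rfl
@[simp] lemma ss_2 (w : W k) : ss (p :: p :: w) = p :: p :: F w := rfl
@[simp] lemma ss_3 (w : W k) : ss (p :: q :: w) = q :: w := rfl
@[simp] lemma ss_4 (j : Fin k) (w : W k) : ss (p :: h j :: w) = h j :: w := rfl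
@[simp] lemma ss_5 (w : W k) : ss (q :: w) = p :: q :: w := rfl
@[simp] lemma ss_6 (j : Fin k) (w : W k) : ss (h j :: w) = p :: h j :: w := rfl
@[simp] lemma ss_inv : (ss : Equiv.Perm (W k))⁻¹ = ss := rfl

/-- `φ` acts by automorphisms with local permutations `π`. -/
def Good (τ : Ty) (φ : Equiv.Perm (W k)) (π : W k → Equiv.Perm (Lt k)) : Prop :=
  ∀ m (x : Pt k), x ≠ .inl m → (τ = .O → ∃ w, x = .inl w) →
    dir τ (φ m) (Sum.map φ id x) = π m (dir τ m x)

lemma dir_flip (m : W k) (x : Pt k) (hx : x ≠ .inl m) :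
    dir .E (F m) (Sum.map F not x) = (if m = [] then sw else 1) (dir .E m x) := by
  rcases m with _ | ⟨_ | _ | i, m⟩ <;>
  rcases x with (_ | ⟨_ | _ | j, w⟩) | _ | _ <;> simp at hx ⊢

/-- Exceptional permutation. -/
def sp (S : Finset (W k)) (m : W k) : Equiv.Perm (Lt k) := if m ∈ S then sw else 1

lemma good_cc : Good .L (cc : Equiv.Perm (W k)) (sp {[p, q]}) := by
  intro m x hx _
  rcases m with _ | ⟨_ | _ | i, _ | ⟨_ | _ | i', w⟩⟩
  case cons.p.cons.q =>
    have key : pr .L p (pr .L q (Sum.map cc id x)) = Sum.map F not (pr .E q (pr .L p x)) := by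
      rcases x with (_ | ⟨_ | _ | j, _ | ⟨_ | _ | j', v⟩⟩) | s <;> simp
    have h2 := dir_flip w (pr .E q (pr .L p x)) (pr_ne (pr_ne hx))
    simp only [cc_3, dir_cons, ch_Lq, ch_Lp, ch_Eq, key, h2]
    simp [sp]
  all_goals
    rcases x with (_ | ⟨_ | _ | j, _ | ⟨_ | _ | j', v⟩⟩) | s <;> simp [sp] at hx ⊢

lemma good_xx : Good .E (xx : Equiv.Perm (W k)) (sp {[], [p, q]}) := by
  intro m x hx _
  rcases m with _ | ⟨_ | _ | i, _ | ⟨_ | _ | i', w⟩⟩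
  case cons.p.cons.q =>
    have key : pr .E q (pr .E q (Sum.map xx id x)) = Sum.map F not (pr .E q (pr .E p x)) := by
      rcases x with (_ | ⟨_ | _ | j, _ | ⟨_ | _ | j', v⟩⟩) | _ | _ <;> simp
    have h2 := dir_flip w (pr .E q (pr .E p x)) (pr_ne (pr_ne hx))
    simp only [xx_3, dir_cons, ch_Ep, ch_Eq, key, h2]
    simp [sp]
  all_goals
    rcases x with (_ | ⟨_ | _ | j, _ | ⟨_ | _ | j', v⟩⟩) | _ | _ <;> simp [sp] at hx ⊢

lemma good_ss : Good .O (ss : Equiv.Perm (W k)) (sp {[p, p]}) := by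
  intro m x hx hO
  obtain ⟨x, rfl⟩ := hO rfl
  rcases m with _ | ⟨_ | _ | i, _ | ⟨_ | _ | i', w⟩⟩
  case cons.p.cons.p =>
    have key : pr .L p (pr .O p (Sum.map ss id (.inl x))) =
        Sum.map F not (pr .L p (pr .O p (.inl x))) := by
      rcases x with (_ | ⟨_ | _ | j, _ | ⟨_ | _ | j', v⟩⟩) <;> simp
    have h2 := dir_flip w (pr .L p (pr .O p (.inl x))) (pr_ne (pr_ne hx))
    simp only [ss_2, dir_cons, ch_Lp, ch_O, key, h2]
    simp [sp]
  all_goals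
    rcases x with (_ | ⟨_ | _ | j, _ | ⟨_ | _ | j', v⟩⟩) <;> simp [sp] at hx ⊢

end Waz

namespace Waz
open Lt
variable {k : ℕ}

lemma map_ne {φ : Equiv.Perm (W k)} {m : W k} {x : Pt k} (hx : x ≠ .inl m) :
    Sum.map φ id x ≠ .inl (φ m) := by
  rcases x with x | s
  · simpa using hx
  · simp

lemma Good.one (τ : Ty) : Good τ (1 : Equiv.Perm (W k)) (fun _ => 1) := by
  intro m x _ _
  rcases x with x | s <;> simp

lemma Good.mul {τ : Ty} {φ ψ : Equiv.Perm (W k)} {π ρ : W k → Equiv.Perm (Lt k)} (h1 : Good τ φ π)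
    (h2 : Good τ ψ ρ) : Good τ (φ * ψ) (fun m => π (ψ m) * ρ m) := by
  intro m x hx hO
  have e1 := h2 m x hx hO
  have e2 := h1 (ψ m) (Sum.map ψ id x) (map_ne hx)
    (by intro h; obtain ⟨w, rfl⟩ := hO h; exact ⟨ψ w, rfl⟩)
  rw [e1] at e2
  beta_reduce
  rw [Equiv.Perm.mul_apply, Equiv.Perm.mul_apply, ← e2]
  rcases x with x | s <;> simp

lemma Good.inv {τ : Ty} {φ : Equiv.Perm (W k)} {π : W k → Equiv.Perm (Lt k)} (h1 : Good τ φ π) :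
    Good τ φ⁻¹ (fun m => (π (φ⁻¹ m))⁻¹) := by
  intro m x hx hO
  have e2 := h1 (φ⁻¹ m) (Sum.map (φ⁻¹ : Equiv.Perm (W k)) id x) (map_ne hx)
    (by intro h; obtain ⟨w, rfl⟩ := hO h; exact ⟨φ⁻¹ w, rfl⟩)
  rw [Equiv.Perm.eq_inv_iff_eq, ← e2]
  rcases x with x | s <;> simp

/-- Condition on a permutation to be allowed at the root of a cell. -/
def Fx (τ : Ty) (σ : Equiv.Perm (Lt k)) : Prop := τ ≠ .O → ∀ s, σ (adj τ s) = adj τ s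

lemma Fx.ch {τ : Ty} {σ : Equiv.Perm (Lt k)} (hσ : Fx τ σ) (a : Lt k) : ch τ (σ a) = ch τ a := by
  cases τ with
  | O => rfl
  | L =>
    have hp : σ p = p := by simpa using hσ (by simp) true
    cases a with
    | p => rw [hp]
    | q =>
      have : σ q ≠ p := fun h => by rw [← hp] at h; simpa using σ.injective h
      cases hq : σ q <;> simp_all
    | h j =>
      have : σ (h j) ≠ p := fun h => by rw [← hp] at h; simpa using σ.injective h
      cases hq : σ (h j) <;> simp_all
  | E =>
    have hp : σ p = p := by simpa using hσ (by simp) false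
    have hq : σ q = q := by simpa using hσ (by simp) true
    cases a with
    | p => rw [hp]
    | q => rw [hq]
    | h j =>
      have h1 : σ (h j) ≠ p := fun h => by rw [← hp] at h; simpa using σ.injective h
      have h2 : σ (h j) ≠ q := fun h => by rw [← hq] at h; simpa using σ.injective h
      cases hq : σ (h j) <;> simp_all

lemma good_hat {τ : Ty} {σ : Equiv.Perm (Lt k)} (hσ : Fx τ σ) :
    Good τ (hat σ) (fun m => if m = [] then σ else 1) := by
  intro m x hx hO
  rcases m with _ | ⟨b, m⟩
  · rcases x with (_ | ⟨d, w⟩) | s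
    · simp at hx
    · simp
    · have hτ : τ ≠ .O := by intro h; obtain ⟨w, hw⟩ := hO h; simp at hw
      simp [hσ hτ s]
  · have key : pr τ (σ b) (Sum.map (hat σ) id x) = pr τ b x := by
      rcases x with (_ | ⟨d, w⟩) | s
      · simp
      · simp
      · have hτ : τ ≠ .O := by intro h; obtain ⟨w, hw⟩ := hO h; simp at hw
        have : adj τ s = σ b ↔ adj τ s = b := by
          conv_lhs => rw [← hσ hτ s]
          exact σ.injective.eq_iff
        simp [this]
    simp [key, hσ.ch]

lemma good_lift {τ : Ty} {a : Lt k} {g : Equiv.Perm (W k)} {π : W k → Equiv.Perm (Lt k)}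
    (hg : Good (ch τ a) g π) :
    Good τ (lift a g) (fun m => match m with | [] => 1 | b :: w => if b = a then π w else 1) := by
  intro m x hx hO
  have e1 : ∀ x : Pt k, fs τ (Sum.map (lift a g) id x) = fs τ x := by
    rintro ((_ | ⟨d, w⟩) | s)
    · simp
    · simp only [Sum.map_inl, lift_cons]; split_ifs <;> simp
    · simp
  have e2 : ∀ b, b ≠ a → pr τ b (Sum.map (lift a g) id x) = pr τ b x := by
    intro b hb
    rcases x with (_ | ⟨d, w⟩) | s
    · simp
    · simp only [Sum.map_inl, lift_cons]; split_ifs with h1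
      · subst h1; simp [hb.symm]
      · simp
    · simp
  have e3 : pr τ a (Sum.map (lift a g) id x) = Sum.map g id (pr τ a x) := by
    rcases x with (_ | ⟨d, w⟩) | s
    · simp
    · simp only [Sum.map_inl, lift_cons]; split_ifs with h1
      · subst h1; simp
      · simp [h1]
    · simp only [Sum.map_inr, pr_tok, id]; split_ifs <;> simp
  rcases m with _ | ⟨b, m⟩
  · simp [e1]
  · by_cases hb : b = a
    · subst hb
      simp only [lift_same, dir_cons, e3, if_true]
      exact hg m _ (pr_ne hx) (fun h => absurd h (ch_ne_O _ _))
    · simp [lift_ne hb, e2 b hb, hb]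

lemma dir_L_tok (m : W k) (s s' : Bool) : dir .L m (.inr s : Pt k) = dir .L m (.inr s') := by
  cases m with
  | nil => simp
  | cons a m => cases a <;> simp

/-- Decomposition of an automorphism fixing the root. -/
lemma children {τ : Ty} {f : Equiv.Perm (W k)} {π : W k → Equiv.Perm (Lt k)} (hf : Good τ f π)
    (h0 : f [] = []) (h1 : π [] = 1) (a : Lt k) :
    ∃ f' π', Good (ch τ a) f' π' ∧ ∀ w, f (a :: w) = a :: f' w := by
  have hd : ∀ b w, ∃ u, f (b :: w) = b :: u := by
    intro b w
    have e := hf [] (.inl (b :: w)) (by simp) (fun _ => ⟨_, rfl⟩)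
    rw [h0, h1] at e
    cases hfb : f (b :: w) with
    | nil => rw [← h0] at hfb; simpa using f.injective hfb
    | cons d u =>
      simp only [Sum.map_inl, dir_nil, hfb, fs_cons, Equiv.Perm.coe_one, id_eq] at e
      exact ⟨u, by rw [e]⟩
  have hdi : ∀ b w, ∃ u, f⁻¹ (b :: w) = b :: u := by
    intro b w
    cases hfb : f⁻¹ (b :: w) with
    | nil =>
      rw [Equiv.Perm.inv_eq_iff_eq] at hfb
      rw [h0] at hfb; simp at hfb
    | cons d u =>
      rw [Equiv.Perm.inv_eq_iff_eq] at hfb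
      obtain ⟨v, hv⟩ := hd d u
      rw [hv] at hfb
      simp only [List.cons.injEq] at hfb
      exact ⟨u, by rw [hfb.1]⟩
  choose F1 hF1 using hd
  choose F2 hF2 using hdi
  let f' : Equiv.Perm (W k) := ⟨F1 a, F2 a, fun w => by
      have := hF2 a (F1 a w)
      rw [← hF1 a w] at this
      simpa using this.symm, fun w => by
      have := hF1 a (F2 a w)
      rw [← hF2 a w] at this
      simpa using this.symm⟩
  have hf' : ∀ w, f (a :: w) = a :: f' w := fun w => hF1 a w
  have hpr : ∀ b w, b ≠ a → pr τ a (.inl (f (b :: w))) = .inr true := by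
    intro b w hb; rw [hF1 b w]; simp [hb]
  refine ⟨f', fun w => π (a :: w), ?_, hf'⟩
  have main : ∀ m x, x ≠ .inl (a :: m) → (τ = .O → ∃ w, x = .inl w) →
      dir (ch τ a) (f' m) (pr τ a (Sum.map f id x)) = π (a :: m) (dir (ch τ a) m (pr τ a x)) := by
    intro m x hx hO
    have := hf (a :: m) x hx hO
    rw [hf'] at this
    simpa using this
  intro m x hx _
  rcases x with w | s
  · simpa [hf'] using main m (.inl (a :: w)) (by simpa using hx) (fun _ => ⟨_, rfl⟩)
  · have ht := main m (.inl []) (by simp) (fun _ => ⟨_, rfl⟩)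
    simp only [Sum.map_inl, h0, pr_nil] at ht
    cases s with
    | true => simpa using ht
    | false =>
      by_cases hch : ch τ a = .L
      · rw [hch] at ht ⊢
        simp only [Sum.map_inr, id]
        rw [dir_L_tok m false true, ← ht, dir_L_tok _ false true]
      · have : τ ≠ .O ∧ ∃ s, adj τ s = a := by
          cases τ <;> cases a <;> simp_all
        obtain ⟨hτ, s, hs⟩ := this
        simpa [hs] using main m (.inr s) (by simp) (fun h => absurd h hτ)

lemma Good.fx {τ : Ty} {f : Equiv.Perm (W k)} {π : W k → Equiv.Perm (Lt k)} (hf : Good τ f π)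
    (h0 : f [] = []) : Fx τ (π []) := by
  intro hτ s
  have := hf [] (.inr s) (by simp) (fun h => absurd h hτ)
  rw [h0] at this
  simpa using this.symm

lemma step {τ : Ty} (H : Subgroup (Equiv.Perm (W k))) (D : Finset (W k))
    {f : Equiv.Perm (W k)} {π : W k → Equiv.Perm (Lt k)} (hf : Good τ f π) (h0 : f [] = [])
    (hσ : ∀ σ, Fx τ σ → hat σ ∈ H)
    (hch : ∀ a f' π', Good (ch τ a) f' π' → ∃ g, lift a g ∈ H ∧ ∀ w, a :: w ∈ D → g w = f' w) :
    ∃ g ∈ H, ∀ d ∈ D, g d = f d := by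
  classical
  have hfx := hf.fx h0
  have hfx' : Fx τ (π [])⁻¹ := by
    intro hτ s
    rw [Equiv.Perm.inv_eq_iff_eq, hfx hτ s]
  have hgood := (good_hat hfx').mul hf
  have hc := fun a => children hgood (by rw [Equiv.Perm.mul_apply, h0, hat_nil]) (by simp [h0]) a
  choose f' π' hgf hf' using hc
  choose g hgH hgD using fun a => hch a (f' a) (π' a) (hgf a)
  have comb : ∀ S : Finset (Lt k), ∃ g' ∈ H, g' [] = [] ∧ (∀ a ∈ S, ∀ w, g' (a :: w) = a :: g a w) ∧
      ∀ a ∉ S, ∀ w, g' (a :: w) = a :: w := by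
    intro S
    induction S using Finset.induction_on with
    | empty => exact ⟨1, H.one_mem, rfl, by simp, by simp⟩
    | insert b S hb ih =>
      obtain ⟨g', h1, h2, h3, h4⟩ := ih
      refine ⟨lift b (g b) * g', H.mul_mem (hgH b) h1, by simp [h2], ?_, ?_⟩
      · intro a ha w
        rcases Finset.mem_insert.mp ha with rfl | ha'
        · simp [h4 a hb]
        · have : a ≠ b := by rintro rfl; exact hb ha'
          simp [h3 a ha', lift_ne this]
      · intro a ha w
        rw [Finset.mem_insert, not_or] at ha
        simp [h4 a ha.2, lift_ne ha.1]
  obtain ⟨g', h1, h2, h3, -⟩ := comb Finset.univ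
  refine ⟨hat (π []) * g', H.mul_mem (hσ _ hfx) h1, ?_⟩
  intro d hd
  have hff : f d = hat (π []) ((hat (π [])⁻¹ * f) d) := by
    rw [map_inv]; simp
  rw [hff, Equiv.Perm.mul_apply]
  congr 1
  rcases d with _ | ⟨a, w⟩
  · rw [h2, Equiv.Perm.mul_apply, h0, hat_nil]
  · rw [h3 a (Finset.mem_univ _), hf', hgD a w hd]

end Waz

namespace Waz
open Lt
variable {k : ℕ}

/-- The element `κ`. -/
def kap : Equiv.Perm (W k) := lift p cc
/-- The element `ξ`. -/
def xi : Equiv.Perm (W k) := lift p (lift p xx)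

/-- The generating set. -/
def genS (k : ℕ) : Set (Equiv.Perm (W k)) := Set.range hat ∪ {ss, kap, xi}

/-- The group (as permutations of the branch points). -/
def GG (k : ℕ) : Subgroup (Equiv.Perm (W k)) := Subgroup.closure (genS k)

lemma hat_mem (σ : Equiv.Perm (Lt k)) : hat σ ∈ GG k :=
  Subgroup.subset_closure (Or.inl ⟨σ, rfl⟩)
lemma ss_mem : ss ∈ GG k := Subgroup.subset_closure (Or.inr (by simp))
lemma kap_mem : kap ∈ GG k := Subgroup.subset_closure (Or.inr (by simp))
lemma xi_mem : xi ∈ GG k := Subgroup.subset_closure (Or.inr (by simp))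

/-- Iterated lift. -/
def liftW : W k → Equiv.Perm (W k) →* Equiv.Perm (W k)
  | [] => MonoidHom.id _
  | a :: w => (lift a).comp (liftW w)

@[simp] lemma liftW_nil (g : Equiv.Perm (W k)) : liftW [] g = g := rfl
lemma liftW_cons (a : Lt k) (w : W k) (g : Equiv.Perm (W k)) :
    liftW (a :: w) g = lift a (liftW w g) := rfl
lemma liftW_app (w : W k) (a : Lt k) (g : Equiv.Perm (W k)) :
    liftW w (lift a g) = liftW (w ++ [a]) g := by
  induction w with
  | nil => rfl
  | cons b w ih => rw [liftW_cons, ih]; rfl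

lemma liftW_in (w v : W k) (g : Equiv.Perm (W k)) : liftW w g (w ++ v) = w ++ g v := by
  induction w with
  | nil => rfl
  | cons b w ih => rw [liftW_cons]; simp [ih]

lemma liftW_out (w : W k) : ∀ (u : W k) (g : Equiv.Perm (W k)), (∀ v, u ≠ w ++ v) →
    liftW w g u = u := by
  induction w with
  | nil => intro u g hu; exact absurd rfl (hu u)
  | cons b w ih =>
    intro u g hu
    rw [liftW_cons]
    rcases u with _ | ⟨d, u⟩
    · rfl
    · by_cases hd : d = b
      · subst hd
        rw [lift_same, ih u g]
        intro v hv; exact hu v (by rw [hv]; rfl)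
      · rw [lift_ne hd]

lemma liftW_conj {w w' : W k} {f : Equiv.Perm (W k)} (hf : ∀ v, f (w ++ v) = w' ++ v)
    (g : Equiv.Perm (W k)) : liftW w g = f⁻¹ * liftW w' g * f := by
  ext1 u
  rw [Equiv.Perm.mul_apply, Equiv.Perm.mul_apply]
  by_cases hu : ∃ v, u = w ++ v
  · obtain ⟨v, rfl⟩ := hu
    rw [liftW_in, hf, liftW_in, ← hf]
    simp
  · push Not at hu
    rw [liftW_out w u g hu, liftW_out w' (f u) g]
    · simp
    · intro v hv
      rw [← hf] at hv
      exact hu v (f.injective hv)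

/-- Type of the cell of a word, starting with `τ`. -/
def tyF (τ : Ty) (w : W k) : Ty := w.foldl ch τ
@[simp] lemma tyF_nil (τ : Ty) : tyF τ ([] : W k) = τ := rfl
@[simp] lemma tyF_cons (τ : Ty) (a : Lt k) (w : W k) : tyF τ (a :: w) = tyF (ch τ a) w := rfl
lemma tyF_app (τ : Ty) (w : W k) (a : Lt k) : tyF τ (w ++ [a]) = ch (tyF τ w) a := by
  simp [tyF]
@[simp] lemma tyF_F (w : W k) : tyF .E (F w) = tyF .E w := by
  rcases w with _ | ⟨_ | _ | j, w⟩ <;> simp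

/-- Representatives. -/
def rep : Ty → W k
  | .O => []
  | .L => [p]
  | .E => [p, p]

lemma tyF_ne_O {τ : Ty} (hτ : τ ≠ .O) (w : W k) : tyF τ w ≠ .O := by
  induction w generalizing τ with
  | nil => simpa using hτ
  | cons a w ih => exact ih (ch_ne_O _ _)

lemma F_app {w : W k} (hw : w ≠ []) (v : W k) : F (w ++ v) = F w ++ v := by
  rcases w with _ | ⟨_ | _ | j, w⟩ <;> simp at hw ⊢

lemma cell_trans (n : ℕ) : ∀ w : W k, w.length ≤ n →
    ∃ f ∈ GG k, ∀ v, f (w ++ v) = rep (tyF .O w) ++ v := by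
  induction n with
  | zero =>
    intro w hw
    have : w = [] := List.length_eq_zero_iff.mp (by omega)
    subst this
    exact ⟨1, one_mem _, by simp [rep]⟩
  | succ n ih =>
    intro w hw
    rcases w with _ | ⟨a, w⟩
    · exact ⟨1, one_mem _, by simp [rep]⟩
    suffices hs : ∃ f ∈ GG k, ∀ v, f (p :: w ++ v) = rep (tyF .O (p :: w)) ++ v by
      obtain ⟨f, hf, hfv⟩ := hs
      refine ⟨f * hat (Equiv.swap a p), mul_mem hf (hat_mem _), fun v => ?_⟩
      rw [Equiv.Perm.mul_apply, List.cons_append, hat_cons, Equiv.swap_apply_left]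
      exact hfv v
    rcases w with _ | ⟨b, w⟩
    · exact ⟨1, one_mem _, by simp [rep]⟩
    by_cases hb : b = p
    · subst hb
      rcases w with _ | ⟨_ | _ | j, w⟩
      · exact ⟨1, one_mem _, by simp [rep]⟩
      · obtain ⟨f, hf, hfv⟩ := ih (p :: p :: w) (by simp at hw ⊢; omega)
        refine ⟨f * kap, mul_mem hf kap_mem, fun v => ?_⟩
        simpa [kap] using hfv v
      · rcases hw0 : w with _ | ⟨d, w'⟩
        · refine ⟨ss * hat sw * ss * kap, mul_mem (mul_mem (mul_mem ss_mem (hat_mem _)) ss_mem)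
            kap_mem, fun v => ?_⟩
          simp [kap, rep]
        · rw [← hw0]
          obtain ⟨f, hf, hfv⟩ := ih (q :: p :: F w) (by
            rw [hw0] at hw ⊢
            cases d <;> simp at hw ⊢ <;> omega)
          refine ⟨f * ss * kap, mul_mem (mul_mem hf ss_mem) kap_mem, fun v => ?_⟩
          have hne : w ≠ [] := by rw [hw0]; simp
          simpa [kap, F_app hne] using hfv v
      · obtain ⟨f, hf, hfv⟩ := ih (p :: h j :: w) (by simp at hw ⊢; omega)
        refine ⟨f * kap, mul_mem hf kap_mem, fun v => ?_⟩
        simpa [kap] using hfv v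
    · obtain ⟨f, hf, hfv⟩ := ih (b :: w) (by simp at hw ⊢; omega)
      refine ⟨f * ss, mul_mem hf ss_mem, fun v => ?_⟩
      have := hfv v
      cases b <;> simp_all

/-- Local groups. -/
def PQ (τ : Ty) : Subgroup (Equiv.Perm (W k)) where
  carrier := {g | (∃ π, Good τ g π) ∧ ∀ w, tyF .O w = τ → liftW w g ∈ GG k}
  one_mem' := ⟨⟨_, Good.one τ⟩, fun w _ => by rw [map_one]; exact one_mem _⟩
  mul_mem' := by
    rintro a b ⟨⟨π, h1⟩, h2⟩ ⟨⟨ρ, h3⟩, h4⟩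
    exact ⟨⟨_, h1.mul h3⟩, fun w hw => by rw [map_mul]; exact mul_mem (h2 w hw) (h4 w hw)⟩
  inv_mem' := by
    rintro a ⟨⟨π, h1⟩, h2⟩
    exact ⟨⟨_, h1.inv⟩, fun w hw => by rw [map_inv]; exact inv_mem (h2 w hw)⟩

lemma mem_PQ {τ : Ty} {g : Equiv.Perm (W k)} {π : W k → Equiv.Perm (Lt k)} (h1 : Good τ g π)
    (h2 : liftW (rep τ) g ∈ GG k) : g ∈ PQ τ := by
  refine ⟨⟨π, h1⟩, fun w hw => ?_⟩
  obtain ⟨f, hf, hfv⟩ := cell_trans w.length w le_rfl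
  rw [hw] at hfv
  rw [liftW_conj hfv g]
  exact mul_mem (mul_mem (inv_mem hf) h2) hf

lemma PQ_lift {τ : Ty} {a : Lt k} {g : Equiv.Perm (W k)} (hg : g ∈ PQ (ch τ a)) :
    lift a g ∈ PQ τ := by
  obtain ⟨⟨π, h1⟩, h2⟩ := hg
  refine ⟨⟨_, good_lift h1⟩, fun w hw => ?_⟩
  rw [liftW_app]
  exact h2 _ (by rw [tyF_app, hw])

lemma PQ_O {g : Equiv.Perm (W k)} (hg : g ∈ PQ .O) : g ∈ GG k := hg.2 [] rfl

lemma cc_mem : cc ∈ PQ (k := k) .L := mem_PQ good_cc kap_mem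
lemma xx_mem : xx ∈ PQ (k := k) .E := mem_PQ good_xx xi_mem
lemma ss_mem' : ss ∈ PQ (k := k) .O := mem_PQ good_ss ss_mem

lemma ss_hat {σ : Equiv.Perm (Lt k)} (hσ : σ p = p) : lift p (hat σ) = ss * hat σ * ss := by
  have hne : ∀ a, a ≠ p → σ a ≠ p := fun a ha h => ha (σ.injective (h.trans hσ.symm))
  have hs : ∀ (a : Lt k) (w : W k), a ≠ p → ss (a :: w) = p :: a :: w := by
    intro a w ha; cases a <;> simp at ha ⊢
  have hs' : ∀ (a : Lt k) (w : W k), a ≠ p → ss (p :: a :: w) = a :: w := by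
    intro a w ha; cases a <;> simp at ha ⊢
  ext1 u
  rcases u with _ | ⟨a, u⟩
  · simp [hσ]
  · by_cases ha : a = p
    · subst ha
      rcases u with _ | ⟨b, u⟩
      · simp
      · by_cases hb : b = p
        · subst hb; simp [hσ]
        · simp [hs' b u hb, hs _ _ (hne b hb)]
    · simp [lift_ne ha, hs a u ha, hσ, hs' a u ha]

lemma cc_hat {σ : Equiv.Perm (Lt k)} (hσ : σ p = p) (hσ' : σ q = q) :
    lift p (hat σ) = cc⁻¹ * hat σ * cc := by
  have hh : ∀ j, ∃ j', σ (h j) = h j' := by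
    intro j
    cases hj : σ (h j) with
    | p => rw [← hσ] at hj; simpa using σ.injective hj
    | q => rw [← hσ'] at hj; simpa using σ.injective hj
    | h j' => exact ⟨j', rfl⟩
  rw [mul_assoc, eq_inv_mul_iff_mul_eq]
  ext1 u
  rcases u with _ | ⟨_ | _ | j, _ | ⟨_ | _ | j', w⟩⟩ <;> simp [hσ, hσ']
  obtain ⟨i, hi⟩ := hh j'
  simp [hi]

lemma PQ_hat {τ : Ty} {σ : Equiv.Perm (Lt k)} (hσ : Fx τ σ) : hat σ ∈ PQ τ := by
  refine mem_PQ (good_hat hσ) ?_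
  cases τ with
  | O => exact hat_mem σ
  | L =>
    have hp : σ p = p := by simpa using hσ (by simp) true
    change lift p (hat σ) ∈ _
    rw [ss_hat hp]
    exact mul_mem (mul_mem ss_mem (hat_mem _)) ss_mem
  | E =>
    have hp : σ p = p := by simpa using hσ (by simp) false
    have hq : σ q = q := by simpa using hσ (by simp) true
    change lift p (lift p (hat σ)) ∈ _
    rw [cc_hat hp hq, map_mul, map_mul, map_inv, ss_hat hp]
    exact mul_mem (mul_mem (inv_mem kap_mem) (mul_mem (mul_mem ss_mem (hat_mem _)) ss_mem)) kap_mem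

lemma PQ_trans (n : ℕ) : (∀ v : W k, v.length ≤ n → ∃ g ∈ PQ .L, g v = []) ∧
    (∀ v : W k, v.length ≤ n → ∃ g ∈ PQ .E, g v = [] ∨ ∃ j, g v = [h j]) := by
  induction n with
  | zero =>
    constructor <;> intro v hv
    · have hv0 : v = [] := List.length_eq_zero_iff.mp (by omega)
      exact ⟨1, one_mem _, hv0⟩
    · have hv0 : v = [] := List.length_eq_zero_iff.mp (by omega)
      exact ⟨1, one_mem _, Or.inl hv0⟩
  | succ n ih =>
    obtain ⟨ihP, ihQ⟩ := ih
    have hfin : ∀ a : Lt k, a ≠ p → ∃ g ∈ PQ .L, g [a] = [] := by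
      intro a ha
      refine ⟨cc⁻¹ * hat (Equiv.swap a q), mul_mem (inv_mem cc_mem) (PQ_hat ?_), ?_⟩
      · intro _ s
        exact Equiv.swap_apply_of_ne_of_ne (by simpa using Ne.symm ha) (by simp)
      · rw [Equiv.Perm.mul_apply, hat_cons, Equiv.swap_apply_left, Equiv.Perm.inv_eq_iff_eq]; rfl
    constructor
    · intro v hv
      rcases v with _ | ⟨a, u⟩
      · exact ⟨1, one_mem _, rfl⟩
      have hu : u.length ≤ n := by simp at hv; omega
      by_cases ha : a = p
      · subst ha
        obtain ⟨g, hg, h1 | ⟨j, h1⟩⟩ := ihQ u hu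
        · exact ⟨cc * lift p g, mul_mem cc_mem (PQ_lift (by simpa using hg)), by simp [h1]⟩
        · obtain ⟨g', hg', h2⟩ := hfin (h j) (by simp)
          exact ⟨g' * (cc * lift p g), mul_mem hg' (mul_mem cc_mem (PQ_lift (by simpa using hg))),
            by simp [h1, h2]⟩
      · obtain ⟨g, hg, h1⟩ := ihP u hu
        obtain ⟨g', hg', h2⟩ := hfin a ha
        refine ⟨g' * lift a g, mul_mem hg' (PQ_lift ?_), by simp [h1, h2]⟩
        cases a <;> simp_all
    · intro v hv
      rcases v with _ | ⟨a, u⟩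
      · exact ⟨1, one_mem _, Or.inl rfl⟩
      have hu : u.length ≤ n := by simp at hv; omega
      cases a with
      | p =>
        obtain ⟨g, hg, h1⟩ := ihQ u hu
        refine ⟨xx * lift p g, mul_mem xx_mem (PQ_lift (by simpa using hg)), ?_⟩
        rcases h1 with h1 | ⟨j, h1⟩ <;> simp [h1]
      | q =>
        obtain ⟨g, hg, h1⟩ := ihQ u hu
        refine ⟨xx⁻¹ * lift q g, mul_mem (inv_mem xx_mem) (PQ_lift (by simpa using hg)), ?_⟩
        rcases h1 with h1 | ⟨j, h1⟩
        · left
          rw [Equiv.Perm.mul_apply, lift_same, h1, Equiv.Perm.inv_eq_iff_eq]; rfl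
        · right
          refine ⟨j, ?_⟩
          rw [Equiv.Perm.mul_apply, lift_same, h1, Equiv.Perm.inv_eq_iff_eq]; rfl
      | h j =>
        obtain ⟨g, hg, h1⟩ := ihP u hu
        exact ⟨lift (h j) g, PQ_lift (by simpa using hg), Or.inr ⟨j, by simp [h1]⟩⟩

/-- Approximation property. -/
def Ap (k : ℕ) (τ : Ty) (n : ℕ) : Prop :=
  ∀ D : Finset (W k), D.card ≤ n → ∀ f π, Good τ f π → ∃ g ∈ PQ τ, ∀ d ∈ D, g d = f d

lemma card_child (D : Finset (W k)) (a : Lt k) {v : W k} (hv : v ∈ D) (hva : ∀ w, v ≠ a :: w) :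
    (D.preimage (a :: ·) (fun _ _ _ _ hh => by simpa using hh)).card < D.card := by
  classical
  rw [← Finset.card_image_of_injective (f := fun w : W k => a :: w) _
    (fun _ _ hh => by simpa using hh)]
  refine Finset.card_lt_card ?_
  rw [Finset.ssubset_iff]
  refine ⟨v, ?_, ?_⟩
  · simp only [Finset.mem_image, not_exists, not_and]
    intro w _ hw; exact hva w hw.symm
  · intro u hu
    rcases Finset.mem_insert.mp hu with rfl | hu
    · exact hv
    · obtain ⟨w, hw, rfl⟩ := Finset.mem_image.mp hu
      exact Finset.mem_preimage.mp hw

lemma card_child_le (D : Finset (W k)) (a : Lt k) :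
    (D.preimage (a :: ·) (fun _ _ _ _ hh => by simpa using hh)).card ≤ D.card := by
  classical
  rw [← Finset.card_image_of_injective (f := fun w : W k => a :: w) _
    (fun _ _ hh => by simpa using hh)]
  refine Finset.card_le_card ?_
  intro u hu
  obtain ⟨w, hw, rfl⟩ := Finset.mem_image.mp hu
  exact Finset.mem_preimage.mp hw

/-- Change of coordinates in the approximation property. -/
lemma approx_conj {H : Subgroup (Equiv.Perm (W k))} {D : Finset (W k)} {f g1 g2 : Equiv.Perm (W k)}
    (h1 : g1 ∈ H) (h2 : g2 ∈ H)
    (hh : ∃ g ∈ H, ∀ d ∈ D.map g1.toEmbedding, g d = (g2 * f * g1⁻¹) d) :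
    ∃ g ∈ H, ∀ d ∈ D, g d = f d := by
  obtain ⟨g, hg, hgd⟩ := hh
  refine ⟨g2⁻¹ * g * g1, mul_mem (mul_mem (inv_mem h2) hg) h1, fun d hd => ?_⟩
  have := hgd (g1 d) (Finset.mem_map_of_mem _ hd)
  rw [Equiv.Perm.mul_apply, Equiv.Perm.mul_apply, this]
  simp

lemma ap_all (n : ℕ) : Ap k .L n ∧ Ap k .E n := by
  induction n using Nat.strong_induction_on with
  | _ n ih =>
    have ih' : ∀ (τ : Ty) (a : Lt k) (m : ℕ), m < n → Ap k (ch τ a) m := by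
      intro τ a m hm
      cases hc : ch τ a with
      | O => exact absurd hc (ch_ne_O _ _)
      | L => exact (ih m hm).1
      | E => exact (ih m hm).2
    have hL : Ap k .L n := by
      intro D hD f π hf
      rcases D.eq_empty_or_nonempty with rfl | ⟨d, hd⟩
      · exact ⟨1, one_mem _, by simp⟩
      obtain ⟨g1, hg1, e1⟩ := (PQ_trans d.length).1 d le_rfl
      obtain ⟨g2, hg2, e2⟩ := (PQ_trans (f d).length).1 (f d) le_rfl
      obtain ⟨⟨π1, hπ1⟩, -⟩ := id hg1
      obtain ⟨⟨π2, hπ2⟩, -⟩ := id hg2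
      refine approx_conj hg1 hg2 (step (PQ .L) _ ((hπ2.mul hf).mul hπ1.inv) ?_
        (fun σ hσ => PQ_hat hσ) ?_)
      · have e3 : g1⁻¹ [] = d := by rw [Equiv.Perm.inv_eq_iff_eq, e1]
        rw [Equiv.Perm.mul_apply, e3, Equiv.Perm.mul_apply, e2]
      · intro a f' π' hf'
        have hmem : ([] : W k) ∈ D.map g1.toEmbedding := by
          rw [← e1]; exact Finset.mem_map_of_mem _ hd
        have hlt := card_child _ a hmem (by simp)
        rw [Finset.card_map] at hlt
        obtain ⟨g, hg, hgd⟩ := ih' .L a _ (lt_of_lt_of_le hlt hD) _ le_rfl f' π' hf'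
        exact ⟨g, PQ_lift hg, fun w hw => hgd w (Finset.mem_preimage.mpr hw)⟩
    refine ⟨hL, ?_⟩
    intro D hD f π hf
    rcases D.eq_empty_or_nonempty with rfl | ⟨d, hd⟩
    · exact ⟨1, one_mem _, by simp⟩
    obtain ⟨g1, hg1, e1⟩ := (PQ_trans d.length).2 d le_rfl
    obtain ⟨g2, hg2, e2⟩ := (PQ_trans (f (g1⁻¹ [])).length).2 (f (g1⁻¹ [])) le_rfl
    obtain ⟨⟨π1, hπ1⟩, -⟩ := id hg1
    obtain ⟨⟨π2, hπ2⟩, -⟩ := id hg2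
    have hG := (hπ2.mul hf).mul hπ1.inv
    refine approx_conj hg1 hg2 (step (PQ .E) _ hG ?_ (fun σ hσ => PQ_hat hσ) ?_)
    · rcases e2 with e2 | ⟨j, e2⟩
      · exact e2
      · exfalso
        have t1 := hG [] (.inr false) (by simp) (by simp)
        have t2 := hG [] (.inr true) (by simp) (by simp)
        have e3 : (g2 * f * g1⁻¹) [] = [h j] := e2
        rw [e3] at t1 t2
        simp only [Sum.map_inr, id, dir_cons, ch_Eh, pr_tok, adj_Ef, adj_Et, reduceCtorEq, if_false,
          dir_nil, fs_tok] at t1 t2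
        have := (Equiv.injective _) (t1.symm.trans t2)
        simp at this
    · intro a f' π' hf'
      by_cases ha : ∃ j, a = h j
      · obtain ⟨j, rfl⟩ := ha
        obtain ⟨g, hg, hgd⟩ := hL _ (le_trans (card_child_le (D.map g1.toEmbedding) (h j))
          (by rw [Finset.card_map]; exact hD)) f' π' hf'
        exact ⟨g, PQ_lift (τ := .E) hg, fun w hw => hgd w (Finset.mem_preimage.mpr hw)⟩
      · have hmem : g1 d ∈ D.map g1.toEmbedding := Finset.mem_map_of_mem _ hd
        have hlt := card_child _ a hmem (by
          rcases e1 with e1 | ⟨j, e1⟩ <;> rw [e1]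
          · simp
          · intro w hw
            simp only [List.cons.injEq] at hw
            exact ha ⟨j, hw.1.symm⟩)
        rw [Finset.card_map] at hlt
        obtain ⟨g, hg, hgd⟩ := ih' .E a _ (lt_of_lt_of_le hlt hD) _ le_rfl f' π' hf'
        exact ⟨g, PQ_lift hg, fun w hw => hgd w (Finset.mem_preimage.mpr hw)⟩

lemma GG_trans (v : W k) : ∃ g ∈ PQ .O, g v = [] := by
  rcases v with _ | ⟨a, u⟩
  · exact ⟨1, one_mem _, rfl⟩
  obtain ⟨g, hg, h1⟩ := (PQ_trans u.length).1 u le_rfl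
  refine ⟨ss * hat (Equiv.swap a p) * lift a g, mul_mem (mul_mem ss_mem' (PQ_hat (by simp [Fx])))
    (PQ_lift (by simpa using hg)), by simp [h1]⟩

/-- Density, combinatorially. -/
theorem GG_dense (D : Finset (W k)) {f : Equiv.Perm (W k)} {π : W k → Equiv.Perm (Lt k)}
    (hf : Good .O f π) : ∃ g ∈ GG k, ∀ d ∈ D, g d = f d := by
  obtain ⟨g2, hg2, e2⟩ := GG_trans (f [])
  obtain ⟨⟨π2, hπ2⟩, -⟩ := id hg2
  have : ∃ g ∈ PQ .O, ∀ d ∈ D, g d = f d := by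
    refine approx_conj (one_mem _) hg2 (step (PQ .O) _ ((hπ2.mul hf).mul (Good.one _).inv) ?_
      (fun σ hσ => PQ_hat hσ) ?_)
    · simp [e2]
    · intro a f' π' hf'
      obtain ⟨g, hg, hgd⟩ := (ap_all _).1 _ le_rfl f' π' hf'
      exact ⟨g, PQ_lift (τ := .O) hg, fun w hw => hgd w
        (Finset.mem_preimage (hf := fun _ _ _ _ hh => by simpa using hh).mpr hw)⟩
  obtain ⟨g, hg, hgd⟩ := this
  exact ⟨g, PQ_O hg, hgd⟩

end Waz

namespace Waz
open Lt
variable {k : ℕ}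

lemma rel_s : (ss * kap * ss : Equiv.Perm (W k)) = hat sw * (ss * kap) := by
  ext1 u
  rcases u with _ | ⟨_ | _ | j, _ | ⟨_ | _ | j, _ | ⟨_ | _ | j, w⟩⟩⟩ <;> simp [kap]

lemma rel_x : (xx * xx : Equiv.Perm (W k)) = lift q xx⁻¹ * xx * lift p xx := by
  rw [map_inv, mul_assoc, eq_inv_mul_iff_mul_eq]
  ext1 u
  rcases u with _ | ⟨_ | _ | j, _ | ⟨_ | _ | j, _ | ⟨_ | _ | j, w⟩⟩⟩ <;> simp

/-- Class in the abelianization. -/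
def cl (g : Equiv.Perm (W k)) (hg : g ∈ GG k) : Abelianization (GG k) := Abelianization.of ⟨g, hg⟩

lemma cl_mul {g g' : Equiv.Perm (W k)} (hg : g ∈ GG k) (hg' : g' ∈ GG k) :
    cl (g * g') (mul_mem hg hg') = cl g hg * cl g' hg' :=
  map_mul Abelianization.of (⟨g, hg⟩ : GG k) ⟨g', hg'⟩
lemma cl_one : cl (1 : Equiv.Perm (W k)) (one_mem _) = 1 := map_one Abelianization.of
lemma cl_inv {g : Equiv.Perm (W k)} (hg : g ∈ GG k) : cl g⁻¹ (inv_mem hg) = (cl g hg)⁻¹ :=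
  map_inv Abelianization.of (⟨g, hg⟩ : GG k)
lemma cl_congr {g g' : Equiv.Perm (W k)} (hg : g ∈ GG k) (e : g = g') : cl g hg = cl g' (e ▸ hg) := by
  subst e; rfl
lemma cl_conj {g g' f : Equiv.Perm (W k)} (hg : g ∈ GG k) (hg' : g' ∈ GG k) (hf : f ∈ GG k)
    (e : g = f⁻¹ * g' * f) : cl g hg = cl g' hg' := by
  rw [cl_congr hg e, cl_mul (mul_mem (inv_mem hf) hg') hf, cl_mul (inv_mem hf) hg', cl_inv hf]
  rw [mul_comm, mul_inv_cancel_left]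

lemma cl_swap (a b : Lt k) (hab : a ≠ b) :
    cl (hat (Equiv.swap a b)) (hat_mem _) = cl (hat sw) (hat_mem _) := by
  obtain ⟨c, hc⟩ := isConj_iff.mp (Equiv.Perm.isConj_swap (show (p : Lt k) ≠ q by simp) hab)
  refine cl_conj _ _ (hat_mem c⁻¹) ?_
  rw [← hc, map_mul, map_mul, map_inv, inv_inv]; rfl

lemma cl_hat (σ : Equiv.Perm (Lt k)) : ∃ n : ℤ, cl (hat σ) (hat_mem _) = cl (hat sw) (hat_mem _) ^ n := by
  induction σ using Equiv.Perm.swap_induction_on with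
  | one => exact ⟨0, by rw [zpow_zero, cl_congr _ (map_one hat), cl_one]⟩
  | swap_mul f a b hab ih =>
    obtain ⟨n, hn⟩ := ih
    refine ⟨1 + n, ?_⟩
    rw [cl_congr _ (map_mul hat _ _), cl_mul (hat_mem _) (hat_mem _), hn, cl_swap a b hab,
      zpow_add, zpow_one]

lemma cl_ss : cl (ss : Equiv.Perm (W k)) ss_mem = cl (hat sw) (hat_mem _) := by
  refine cl_conj _ _ (mul_mem ss_mem kap_mem) ?_
  rw [mul_assoc _ (hat sw), ← rel_s]; group

lemma liftW_mem {g : Equiv.Perm (W k)} {τ : Ty} (hg : g ∈ PQ τ) {w : W k} (hw : tyF .O w = τ) :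
    liftW w g ∈ GG k := hg.2 w hw

lemma cl_liftW {g : Equiv.Perm (W k)} {τ : Ty} (hg : g ∈ PQ τ) {w : W k} (hw : tyF .O w = τ)
    (hr : tyF .O (rep τ : W k) = τ) :
    cl (liftW w g) (liftW_mem hg hw) = cl (liftW (rep τ) g) (liftW_mem hg hr) := by
  obtain ⟨f, hf, hfv⟩ := cell_trans w.length w le_rfl
  rw [hw] at hfv
  exact cl_conj _ _ hf (liftW_conj hfv g)

lemma cl_xi : cl (xi : Equiv.Perm (W k)) xi_mem = 1 := by
  have hr : tyF .O (rep .E : W k) = .E := by simp [rep]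
  have h1 := cl_liftW (xx_mem (k := k)) (w := [p, p, p]) (by simp) hr
  have h2 := cl_liftW (inv_mem (xx_mem (k := k))) (w := [p, p, q]) (by simp) hr
  have h0 : liftW (rep .E) xx = (xi : Equiv.Perm (W k)) := rfl
  rw [cl_congr _ h0] at h1
  have h0' : liftW (rep .E) xx⁻¹ = (xi : Equiv.Perm (W k))⁻¹ := by rw [← h0, map_inv]
  rw [cl_congr _ h0', cl_inv xi_mem] at h2
  have e : (xi * xi : Equiv.Perm (W k)) = liftW [p, p, q] xx⁻¹ * xi * liftW [p, p, p] xx := by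
    have := congrArg (fun g => lift p (lift p g)) (rel_x (k := k))
    simp only [map_mul] at this
    exact this
  have h3 := cl_congr (mul_mem xi_mem xi_mem) e
  rw [cl_mul xi_mem xi_mem, cl_mul (mul_mem (liftW_mem (inv_mem xx_mem) (by simp)) xi_mem)
    (liftW_mem xx_mem (by simp)), cl_mul (liftW_mem (inv_mem xx_mem) (by simp)) xi_mem, h1, h2] at h3
  simpa using h3

lemma cl_all (x : Abelianization (GG k)) :
    ∃ a b : ℤ, x = cl (hat sw) (hat_mem _) ^ a * cl kap kap_mem ^ b := by
  obtain ⟨⟨g, hg⟩, rfl⟩ := QuotientGroup.mk_surjective x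
  change ∃ a b : ℤ, cl g hg = _
  induction hg using Subgroup.closure_induction with
  | mem g hg =>
    rcases hg with ⟨σ, rfl⟩ | hg
    · obtain ⟨n, hn⟩ := cl_hat σ
      exact ⟨n, 0, by simpa using hn⟩
    · simp only [Set.mem_insert_iff, Set.mem_singleton_iff] at hg
      rcases hg with rfl | rfl | rfl
      · exact ⟨1, 0, by simpa using cl_ss⟩
      · exact ⟨0, 1, by simp⟩
      · exact ⟨0, 0, by simpa using cl_xi⟩
  | one => exact ⟨0, 0, by simpa using cl_one⟩
  | mul g g' hg hg' ih ih' =>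
    obtain ⟨a, b, e⟩ := ih
    obtain ⟨a', b', e'⟩ := ih'
    refine ⟨a + a', b + b', ?_⟩
    rw [cl_mul hg hg', e, e', zpow_add, zpow_add, mul_mul_mul_comm]
  | inv g hg ih =>
    obtain ⟨a, b, e⟩ := ih
    refine ⟨-a, -b, ?_⟩
    rw [cl_inv hg, e, mul_inv, zpow_neg, zpow_neg]

lemma cl_sq : cl (hat sw : Equiv.Perm (W k)) (hat_mem _) * cl (hat sw) (hat_mem _) = 1 := by
  rw [← cl_mul, cl_congr _ (map_mul hat sw sw).symm, cl_congr _ (congrArg hat sw_mul),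
    cl_congr _ (map_one hat), cl_one]

end Waz

namespace Waz
open Lt
variable {k : ℕ}

lemma Good.apply {φ : Equiv.Perm (W k)} {π : W k → Equiv.Perm (Lt k)} (hg : Good .O φ π)
    {m x : W k} (hx : x ≠ m) : dO (φ m) (φ x) = π m (dO m x) :=
  hg m (.inl x) (by simpa using hx) (fun _ => ⟨x, rfl⟩)

lemma append_ne (m : W k) (a : Lt k) : m ++ [a] ≠ m := by simp

lemma Good.unique {φ : Equiv.Perm (W k)} {π ρ : W k → Equiv.Perm (Lt k)} (h1 : Good .O φ π)
    (h2 : Good .O φ ρ) : π = ρ := by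
  funext m
  ext1 a
  have e1 := h1.apply (append_ne m a)
  have e2 := h2.apply (append_ne m a)
  rw [dO_append] at e1 e2
  rw [← e1, ← e2]

open Classical in
/-- The local permutations. -/
noncomputable def loc (φ : Equiv.Perm (W k)) : W k → Equiv.Perm (Lt k) :=
  if hh : ∃ π, Good .O φ π then hh.choose else fun _ => 1

lemma Good.loc_eq {φ : Equiv.Perm (W k)} {π : W k → Equiv.Perm (Lt k)} (h1 : Good .O φ π) :
    loc φ = π := by
  have hh : ∃ π, Good .O φ π := ⟨π, h1⟩
  rw [loc, dif_pos hh]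
  exact hh.choose_spec.unique h1

/-- Indicator of type E. -/
def iT : Ty → ℤ
  | .O => 0
  | .L => 0
  | .E => 1
@[simp] lemma iT_O : iT .O = 0 := rfl
@[simp] lemma iT_L : iT .L = 0 := rfl
@[simp] lemma iT_E : iT .E = 1 := rfl

/-- Indicator of type E. -/
def iE (m : W k) : ℤ := iT (tyF .O m)

/-- The abelian target. -/
abbrev AA := ℤˣ × Multiplicative ℤ

/-- The cocycle. -/
noncomputable def coc (φ : Equiv.Perm (W k)) (m : W k) : AA :=
  (Equiv.Perm.sign (loc φ m), Multiplicative.ofAdd (iE (φ m) - iE m))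

lemma coc_mul {φ ψ : Equiv.Perm (W k)} (h1 : ∃ π, Good .O φ π) (h2 : ∃ π, Good .O ψ π) (m : W k) :
    coc (φ * ψ) m = coc φ (ψ m) * coc ψ m := by
  obtain ⟨π, h1⟩ := h1
  obtain ⟨ρ, h2⟩ := h2
  rw [coc, coc, coc, (h1.mul h2).loc_eq, h1.loc_eq, h2.loc_eq, Prod.mk_mul_mk, ← map_mul, ← ofAdd_add,
    Equiv.Perm.mul_apply, sub_add_sub_cancel]

lemma coc_one (m : W k) : coc 1 m = 1 := by
  rw [coc, (Good.one .O).loc_eq]; simp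

lemma coc_inv {φ : Equiv.Perm (W k)} (h1 : ∃ π, Good .O φ π) (m : W k) :
    coc φ⁻¹ m = (coc φ (φ⁻¹ m))⁻¹ := by
  obtain ⟨π, h1⟩ := h1
  have := coc_mul ⟨_, h1⟩ ⟨_, h1.inv⟩ m
  rw [mul_inv_cancel, coc_one] at this
  exact (inv_eq_of_mul_eq_one_right this.symm).symm

/-- Automorphisms with almost trivial cocycle. -/
def Gam (k : ℕ) : Subgroup (Equiv.Perm (W k)) where
  carrier := {φ | (∃ π, Good .O φ π) ∧ (Function.mulSupport (coc φ)).Finite}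
  one_mem' := ⟨⟨_, Good.one .O⟩, by
    rw [show coc (1 : Equiv.Perm (W k)) = 1 from funext coc_one]; simp⟩
  mul_mem' := by
    rintro a b ⟨⟨π, h1⟩, h2⟩ ⟨⟨ρ, h3⟩, h4⟩
    refine ⟨⟨_, h1.mul h3⟩, ((h2.preimage (f := b) b.injective.injOn).union h4).subset ?_⟩
    intro m hm
    by_contra hc
    simp only [Set.mem_union, Set.mem_preimage, Function.mem_mulSupport, not_or, not_not] at hc
    exact hm (by rw [coc_mul ⟨_, h1⟩ ⟨_, h3⟩, hc.1, hc.2, mul_one])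
  inv_mem' := by
    rintro a ⟨⟨π, h1⟩, h2⟩
    refine ⟨⟨_, h1.inv⟩, (h2.preimage (f := (a⁻¹ : Equiv.Perm (W k)))
      (Equiv.injective _).injOn).subset ?_⟩
    intro m hm hc
    exact hm (by rw [coc_inv ⟨_, h1⟩, hc, inv_one])

/-- The homomorphism. -/
noncomputable def Phi (k : ℕ) : Gam k →* AA where
  toFun φ := ∏ᶠ m, coc φ.1 m
  map_one' := by
    rw [← finprod_one (α := W k)]
    exact finprod_congr coc_one
  map_mul' := by
    rintro ⟨φ, h1, h2⟩ ⟨ψ, h3, h4⟩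
    change ∏ᶠ m, coc (φ * ψ) m = _
    rw [finprod_congr (coc_mul h1 h3), finprod_mul_distrib, finprod_comp_equiv ψ (f := coc φ)]
    · exact h2.preimage (f := ψ) ψ.injective.injOn
    · exact h4

lemma gam_of {φ : Equiv.Perm (W k)} {π : W k → Equiv.Perm (Lt k)} (h1 : Good .O φ π)
    (S : Finset (W k)) (h2 : ∀ m, m ∉ S → π m = 1 ∧ iE (φ m) = iE m) : φ ∈ Gam k := by
  refine ⟨⟨π, h1⟩, S.finite_toSet.subset ?_⟩
  intro m hm
  by_contra hc
  obtain ⟨e1, e2⟩ := h2 m (by simpa using hc)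
  exact hm (by rw [coc, h1.loc_eq, e1, e2]; simp)

lemma phi_eq {φ : Equiv.Perm (W k)} {π : W k → Equiv.Perm (Lt k)} (h1 : Good .O φ π)
    (S : Finset (W k)) (h2 : ∀ m, m ∉ S → π m = 1 ∧ iE (φ m) = iE m) (hg : φ ∈ Gam k) :
    Phi k ⟨φ, hg⟩ = ∏ m ∈ S, (Equiv.Perm.sign (π m), Multiplicative.ofAdd (iE (φ m) - iE m)) := by
  change ∏ᶠ m, coc φ m = _
  rw [finprod_eq_prod_of_mulSupport_subset (s := S)]
  · refine Finset.prod_congr rfl fun m _ => ?_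
    rw [coc, h1.loc_eq]
  · intro m hm
    by_contra hc
    obtain ⟨e1, e2⟩ := h2 m (by simpa using hc)
    exact hm (by rw [coc, h1.loc_eq, e1, e2]; simp)

lemma hat_dat (σ : Equiv.Perm (Lt k)) : ∀ m, m ∉ ({[]} : Finset (W k)) →
    (if m = [] then σ else 1) = 1 ∧ iE (hat σ m) = iE m := by
  intro m hm
  rcases m with _ | ⟨a, m⟩
  · simp at hm
  · simp [iE]

lemma ss_dat : ∀ m, m ∉ ({[p, p]} : Finset (W k)) →
    sp {[p, p]} m = 1 ∧ iE (ss m) = iE m := by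
  intro m hm
  refine ⟨by rw [sp, if_neg hm], ?_⟩
  rcases m with _ | ⟨_ | _ | j, _ | ⟨_ | _ | j, w⟩⟩ <;> simp [iE]

lemma iE_cc (m : W k) (hm : m ≠ [p]) : iE (p :: cc m) = iE (p :: m) := by
  rcases m with _ | ⟨_ | _ | j, _ | ⟨_ | _ | j, w⟩⟩ <;> simp [iE] at hm ⊢

lemma iE_xx (m : W k) : iE (p :: p :: xx m) = iE (p :: p :: m) := by
  rcases m with _ | ⟨_ | _ | j, _ | ⟨_ | _ | j, w⟩⟩ <;> simp [iE]

lemma kap_dat : ∀ m : W k, m ∉ ({[p, p], [p, p, q]} : Finset (W k)) →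
    (match m with | [] => 1 | b :: w => if b = p then sp {[p, q]} w else 1) = (1 : Equiv.Perm (Lt k))
      ∧ iE (kap m) = iE m := by
  intro m hm
  rcases m with _ | ⟨b, m⟩
  · simp [kap]
  · by_cases hb : b = p
    · subst hb
      simp only [Finset.mem_insert, List.cons.injEq, true_and, Finset.mem_singleton, not_or] at hm
      refine ⟨by simp [sp, hm.2], ?_⟩
      rw [kap, lift_same, iE_cc _ hm.1]
    · simp [hb, kap, lift_ne]

lemma xi_dat : ∀ m : W k, m ∉ ({[p, p], [p, p, p, q]} : Finset (W k)) →
    (match m with | [] => 1 | b :: w => if b = p then (match w with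
      | [] => 1 | b :: w => if b = p then sp {[], [p, q]} w else 1) else 1) = (1 : Equiv.Perm (Lt k))
      ∧ iE (xi m) = iE m := by
  intro m hm
  rcases m with _ | ⟨b, m⟩
  · simp [xi]
  · by_cases hb : b = p
    · subst hb
      rcases m with _ | ⟨b, m⟩
      · simp [xi]
      · by_cases hb : b = p
        · subst hb
          simp only [Finset.mem_insert, List.cons.injEq, true_and, Finset.mem_singleton, not_or] at hm
          refine ⟨by simp [sp, hm], ?_⟩
          rw [xi, lift_same, lift_same, iE_xx]
        · simp [hb, xi, lift_ne]
    · simp [hb, xi, lift_ne]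

lemma good_kap : Good .O (kap : Equiv.Perm (W k))
    (fun m => match m with | [] => 1 | b :: w => if b = p then sp {[p, q]} w else 1) := good_lift (τ := .O) (a := p) good_cc
lemma good_xi : Good .O (xi : Equiv.Perm (W k))
    (fun m => match m with | [] => 1 | b :: w => if b = p then (match w with
      | [] => 1 | b :: w => if b = p then sp {[], [p, q]} w else 1) else 1) :=
  good_lift (τ := .O) (a := p) (good_lift (τ := .L) (a := p) good_xx)
lemma good_hatO (σ : Equiv.Perm (Lt k)) : Good .O (hat σ) (fun m => if m = [] then σ else 1) :=
  good_hat (by simp [Fx])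

lemma GG_le : GG k ≤ Gam k := by
  rw [GG, Subgroup.closure_le]
  rintro g (⟨σ, rfl⟩ | hg)
  · exact gam_of (good_hatO σ) _ (hat_dat σ)
  · simp only [Set.mem_insert_iff, Set.mem_singleton_iff] at hg
    rcases hg with rfl | rfl | rfl
    · exact gam_of good_ss _ ss_dat
    · exact gam_of good_kap _ kap_dat
    · exact gam_of good_xi _ xi_dat

lemma phi_sw : Phi k ⟨hat sw, GG_le (hat_mem _)⟩ = (-1, 1) := by
  rw [phi_eq (good_hatO sw) _ (hat_dat sw)]
  simp [sw]

lemma phi_kap : Phi k ⟨kap, GG_le kap_mem⟩ = (-1, Multiplicative.ofAdd (-1)) := by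
  rw [phi_eq good_kap _ kap_dat, Finset.prod_pair (by simp)]
  simp [sw, sp, iE, kap]

/-- The homomorphism on the abelianization. -/
noncomputable def PhiG (k : ℕ) : Abelianization (GG k) →* AA :=
  Abelianization.lift ((Phi k).comp (Subgroup.inclusion GG_le))

lemma PhiG_cl {g : Equiv.Perm (W k)} (hg : g ∈ GG k) : PhiG k (cl g hg) = Phi k ⟨g, GG_le hg⟩ :=
  rfl

lemma PhiG_form (a b : ℤ) : PhiG k (cl (hat sw) (hat_mem _) ^ a * cl kap kap_mem ^ b) =
    ((-1) ^ (a + b), Multiplicative.ofAdd (-b)) := by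
  rw [map_mul, map_zpow, map_zpow, PhiG_cl, PhiG_cl, phi_sw, phi_kap]
  ext1
  · simp [zpow_add]
  · simp [← ofAdd_zsmul]

lemma PhiG_bij : Function.Bijective (PhiG k) := by
  constructor
  · rw [injective_iff_map_eq_one]
    intro x hx
    obtain ⟨a, b, rfl⟩ := cl_all x
    rw [PhiG_form] at hx
    have h1 := congrArg Prod.fst hx
    have h2 := congrArg Prod.snd hx
    have hb : b = 0 := by
      have : -b = 0 := h2
      omega
    subst hb
    simp only [add_zero, Prod.fst_one] at h1
    have ha : Even a := by
      by_contra hc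
      rw [Int.not_even_iff_odd] at hc
      rw [hc.neg_one_zpow] at h1
      exact absurd h1 (by decide)
    obtain ⟨c, rfl⟩ := ha
    rw [zpow_zero, mul_one, zpow_add, ← mul_zpow, cl_sq, one_zpow]
  · rintro ⟨u, z⟩
    rcases Int.units_eq_one_or u with rfl | rfl
    · refine ⟨_, (PhiG_form (Multiplicative.toAdd z) (-Multiplicative.toAdd z)).trans ?_⟩
      simp
    · refine ⟨_, (PhiG_form (Multiplicative.toAdd z + 1) (-Multiplicative.toAdd z)).trans ?_⟩
      simp

theorem GG_ab : Nonempty (Abelianization (GG k) ≃* Multiplicative (ZMod 2 × ℤ)) := by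
  have e1 : Abelianization (GG k) ≃* AA := MulEquiv.ofBijective (PhiG k) PhiG_bij
  have e2 : ℤˣ ≃* Multiplicative (ZMod 2) := by
    have : IsCyclic ℤˣ := inferInstance
    refine mulEquivOfCyclicCardEq ?_
    simp
  refine ⟨e1.trans ((MulEquiv.prodCongr e2 (MulEquiv.refl _)).trans ?_)⟩
  exact (MulEquiv.prodMultiplicative (ZMod 2) ℤ).symm

end Waz

namespace Waz
open Lt
variable {k : ℕ}

/-- Automorphisms. -/
def AutO (k : ℕ) : Subgroup (Equiv.Perm (W k)) where
  carrier := {φ | ∃ π, Good .O φ π}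
  one_mem' := ⟨_, Good.one .O⟩
  mul_mem' := by
    rintro a b ⟨π, h1⟩ ⟨ρ, h3⟩
    exact ⟨_, h1.mul h3⟩
  inv_mem' := by
    rintro a ⟨π, h1⟩
    exact ⟨_, h1.inv⟩

lemma GG_le_AutO : GG k ≤ AutO k := fun _ hg => (GG_le hg).1

lemma good_loc (φ : AutO k) : Good .O φ.1 (loc φ.1) := by
  obtain ⟨φ, π, hπ⟩ := φ
  rw [hπ.loc_eq]; exact hπ

lemma loc_dO (φ : AutO k) {m x : W k} (hx : x ≠ m) :
    dO (φ.1 m) (φ.1 x) = loc φ.1 m (dO m x) := (good_loc φ).apply hx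

lemma ptcong (φ : AutO k) (f : XX k) :
    IsPt fun m => (f (φ.1.symm m)).map (loc φ.1 (φ.1.symm m)) := by
  constructor
  · intro m m' hm hf
    obtain ⟨n, rfl⟩ := φ.1.surjective m
    obtain ⟨n', rfl⟩ := φ.1.surjective m'
    have hn : n ≠ n' := fun h => hm (by rw [h])
    simp only [Equiv.symm_apply_apply] at hf ⊢
    rw [loc_dO φ hn.symm] at hf
    rw [loc_dO φ hn, f.c1 hn (fun h => hf (by rw [h]; rfl))]
    rfl
  · intro m a hf
    obtain ⟨n, rfl⟩ := φ.1.surjective m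
    simp only [Equiv.symm_apply_apply] at hf
    obtain ⟨b, hb, -⟩ := Option.map_eq_some_iff.mp hf
    obtain ⟨n', hn', h2⟩ := f.c2 hb
    refine ⟨φ.1 n', fun h => hn' (φ.1.injective h), ?_⟩
    simp only [Equiv.symm_apply_apply]
    rw [loc_dO φ hn'.symm]
    intro h3
    obtain ⟨c, hc, hc'⟩ := Option.map_eq_some_iff.mp h3
    exact h2 (by rw [hc, (loc φ.1 n').injective hc'])

noncomputable def act (φ : AutO k) (f : XX k) : XX k := ⟨_, ptcong φ f⟩

lemma act_apply (φ : AutO k) (f : XX k) (m : W k) :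
    act φ f (φ.1 m) = (f m).map (loc φ.1 m) := by
  change (f (φ.1.symm (φ.1 m))).map _ = _
  rw [Equiv.symm_apply_apply]

lemma act_one (f : XX k) : act 1 f = f := by
  ext m : 1
  have := act_apply 1 f m
  rw [OneMemClass.coe_one, (Good.one .O).loc_eq] at this
  rw [Equiv.Perm.one_apply] at this
  rw [this]
  simp

lemma act_mul (φ ψ : AutO k) (f : XX k) : act (φ * ψ) f = act φ (act ψ f) := by
  ext m : 1
  obtain ⟨n, rfl⟩ := (φ * ψ).1.surjective m
  rw [act_apply]
  rw [Subgroup.coe_mul, Equiv.Perm.mul_apply, act_apply, act_apply,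
    ((good_loc φ).mul (good_loc ψ)).loc_eq, Option.map_map]
  rfl

lemma act_cont (φ : AutO k) : Continuous (act φ) := by
  refine continuous_generateFrom_iff.mpr ?_
  rintro _ ⟨⟨m, a⟩, rfl⟩
  obtain ⟨n, rfl⟩ := φ.1.surjective m
  obtain ⟨b, rfl⟩ := (loc φ.1 n).surjective a
  have : act φ ⁻¹' (UU (φ.1 n) (loc φ.1 n b)) = UU n b := by
    ext f
    simp only [UU, Set.mem_preimage, Set.mem_ofPred_eq, act_apply]
    constructor
    · intro h3
      obtain ⟨c, hc, hc'⟩ := Option.map_eq_some_iff.mp h3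
      rw [hc, (loc φ.1 n).injective hc']
    · intro h; rw [h]; rfl
  change IsOpen (act φ ⁻¹' (UU (φ.1 n) (loc φ.1 n b)))
  rw [this]
  exact isOpen_UU _ _

/-- The action by homeomorphisms. -/
noncomputable def rho : AutO k →* (XX k ≃ₜ XX k) where
  toFun φ :=
    { toFun := act φ
      invFun := act φ⁻¹
      left_inv := fun f => by rw [← act_mul, inv_mul_cancel, act_one]
      right_inv := fun f => by rw [← act_mul, mul_inv_cancel, act_one]
      continuous_toFun := act_cont φ
      continuous_invFun := act_cont φ⁻¹ }
  map_one' := Homeomorph.ext act_one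
  map_mul' φ ψ := Homeomorph.ext (act_mul φ ψ)

lemma rho_apply (φ : AutO k) (f : XX k) : rho φ f = act φ f := rfl

lemma act_io (φ : AutO k) (m : W k) : act φ (io m) = io (φ.1 m) := by
  apply eq_io
  rw [act_apply, io_self]; rfl

lemma rho_inj : Function.Injective (rho (k := k)) := by
  intro φ ψ hh
  apply Subtype.ext
  ext1 m
  have : rho φ (io m) = rho ψ (io m) := by rw [hh]
  rw [rho_apply, rho_apply, act_io, act_io] at this
  exact io_injective this

lemma ptOrder_homeo {X : Type*} [TopologicalSpace X] (h : X ≃ₜ X) (x : X) :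
    ptOrder X (h x) = ptOrder X x := by
  have key : setComponents X {h x}ᶜ = (fun s => h '' s) '' setComponents X {x}ᶜ := by
    have e : ({h x}ᶜ : Set X) = h '' {x}ᶜ := by
      rw [Set.image_compl_eq h.bijective, Set.image_singleton]
    ext C
    constructor
    · rintro ⟨y, hy, rfl⟩
      rw [e] at hy
      obtain ⟨z, hz, rfl⟩ := hy
      exact ⟨_, ⟨z, hz, rfl⟩, by rw [e]; exact h.image_connectedComponentIn hz⟩
    · rintro ⟨_, ⟨z, hz, rfl⟩, rfl⟩
      refine ⟨h z, by rw [e]; exact ⟨z, hz, rfl⟩, ?_⟩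
      rw [e]; exact h.image_connectedComponentIn hz
  rw [ptOrder, ptOrder, key]
  exact Set.ncard_image_of_injective _ (Set.image_injective.mpr h.injective)

lemma homeo_io (hk : 1 ≤ k) (h : XX k ≃ₜ XX k) (m : W k) : ∃ m', h (io m) = io m' := by
  rw [← ptOrder_eq_iff hk, ptOrder_homeo, ptOrder_io]

/-- induced map on branch points -/
noncomputable def hM (hk : 1 ≤ k) (h : XX k ≃ₜ XX k) (m : W k) : W k := (homeo_io hk h m).choose

lemma hM_spec (hk : 1 ≤ k) (h : XX k ≃ₜ XX k) (m : W k) : h (io m) = io (hM hk h m) :=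
  (homeo_io hk h m).choose_spec

lemma hM_symm (hk : 1 ≤ k) (h : XX k ≃ₜ XX k) (m : W k) : hM hk h.symm (hM hk h m) = m := by
  apply io_injective
  rw [← hM_spec, ← hM_spec, Homeomorph.symm_apply_apply]

lemma hM_symm' (hk : 1 ≤ k) (h : XX k ≃ₜ XX k) (m : W k) : hM hk h (hM hk h.symm m) = m := by
  apply io_injective
  rw [← hM_spec, ← hM_spec, Homeomorph.apply_symm_apply]

/-- induced permutation -/
noncomputable def hP (hk : 1 ≤ k) (h : XX k ≃ₜ XX k) : Equiv.Perm (W k) :=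
  ⟨hM hk h, hM hk h.symm, hM_symm hk h, hM_symm' hk h⟩

noncomputable def pf (hk : 1 ≤ k) (h : XX k ≃ₜ XX k) (m : W k) (a : Lt k) : Lt k :=
  dO (hM hk h m) (hM hk h (m ++ [a]))

lemma pf_key (hk : 1 ≤ k) (h : XX k ≃ₜ XX k) {m : W k} {a : Lt k} {f : XX k} (hf : f m = some a) :
    h f (hM hk h m) = some (pf hk h m a) := by
  have hne : hM hk h m ≠ hM hk h (m ++ [a]) := by
    intro e
    have := congrArg (hM hk h.symm) e
    rw [hM_symm, hM_symm] at this
    simp at this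
  have h1 : IsPreconnected (h '' UU m a) :=
    (UU_preconnected m a).image _ h.continuous.continuousOn
  have h2 : io (hM hk h m) ∉ h '' UU m a := by
    rintro ⟨g, hg, hg'⟩
    rw [← hM_spec] at hg'
    rw [h.injective hg'] at hg
    simp [UU] at hg
  have h3 : h (io (m ++ [a])) ∈ h '' UU m a := ⟨_, io_append_mem m a, rfl⟩
  have h4 : h (io (m ++ [a])) (hM hk h m) = some (pf hk h m a) := by
    rw [hM_spec hk, io_ne hne]; rfl
  exact subset_UU h1 h2 h3 h4 ⟨f, hf, rfl⟩

lemma pf_inj (hk : 1 ≤ k) (h : XX k ≃ₜ XX k) (m : W k) : Function.Injective (pf hk h m) := by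
  refine Function.LeftInverse.injective (g := pf hk h.symm (hM hk h m)) fun a => ?_
  have h1 : io (m ++ [a]) m = some a := io_append_mem m a
  have h2 := pf_key hk h.symm (pf_key hk h h1)
  rw [hM_symm, Homeomorph.symm_apply_apply, h1] at h2
  exact (Option.some.inj h2).symm

/-- induced local permutations -/
noncomputable def pP (hk : 1 ≤ k) (h : XX k ≃ₜ XX k) (m : W k) : Equiv.Perm (Lt k) :=
  Equiv.ofBijective (pf hk h m) (Finite.injective_iff_bijective.mp (pf_inj hk h m))

lemma good_hP (hk : 1 ≤ k) (h : XX k ≃ₜ XX k) : Good .O (hP hk h) (pP hk h) := by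
  intro m x hx hO
  obtain ⟨w, rfl⟩ := hO rfl
  have hw : m ≠ w := by rintro rfl; exact hx rfl
  have h1 := pf_key hk h (io_ne hw)
  have h2 : hM hk h m ≠ hM hk h w := fun e => hw ((hP hk h).injective e)
  rw [hM_spec hk, io_ne h2] at h1
  exact Option.some.inj h1

lemma rho_surj (hk : 1 ≤ k) : Function.Surjective (rho (k := k)) := by
  intro h
  refine ⟨⟨hP hk h, _, good_hP hk h⟩, Homeomorph.ext fun f => ?_⟩
  ext m : 1
  obtain ⟨n, rfl⟩ := (hP hk h).surjective m
  rw [rho_apply]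
  refine (act_apply _ f n).trans ?_
  rw [(good_hP hk h).loc_eq]
  cases hf : f n with
  | none =>
    rw [eq_io hf, hM_spec hk]
    exact (io_self _).symm
  | some a => exact (pf_key hk h hf).symm

/-- The group. -/
noncomputable def rhoG (k : ℕ) : GG k →* (XX k ≃ₜ XX k) :=
  (rho (k := k)).comp (Subgroup.inclusion GG_le_AutO)

lemma rhoG_inj : Function.Injective (rhoG k) :=
  rho_inj.comp (Subgroup.inclusion_injective _)

/-- The group. -/
noncomputable def GX (k : ℕ) : Subgroup (XX k ≃ₜ XX k) := (rhoG k).range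

lemma GX_dense (hk : 1 ≤ k) : Dense (GX k : Set (XX k ≃ₜ XX k)) := by
  intro h
  obtain ⟨φ, rfl⟩ := rho_surj hk h
  have hex : ∀ D : Finset (W k), ∃ g ∈ GG k, ∀ d ∈ D, g d = φ.1 d :=
    fun D => GG_dense D (good_loc φ)
  choose g hg hgd using hex
  let gg : Finset (W k) → AutO k := fun D => ⟨g D, GG_le_AutO (hg D)⟩
  refine mem_closure_of_tendsto (f := fun D => rho (gg D)) (b := Filter.atTop) ?_
    (Filter.Eventually.of_forall fun D => ⟨⟨g D, hg D⟩, rfl⟩)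
  rw [nhds_induced, Filter.tendsto_comap_iff, ContinuousMap.tendsto_nhds_compactOpen]
  intro K hK U hU hKU
  have hloc : ∀ x : XX k, Filter.Tendsto (fun z : Finset (W k) × XX k => act (gg z.1) z.2)
      (Filter.atTop ×ˢ nhds x) (nhds (act φ x)) := by
    intro x
    rw [TopologicalSpace.tendsto_nhds_generateFrom_iff]
    rintro _ ⟨⟨m, a⟩, rfl⟩ hx
    obtain ⟨n, rfl⟩ := φ.1.surjective m
    have hx' : act φ x (φ.1 n) = some a := hx
    rw [act_apply] at hx'
    obtain ⟨b, hb, rfl⟩ := Option.map_eq_some_iff.mp hx'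
    have e1 : ∀ᶠ D : Finset (W k) in Filter.atTop, {n, n ++ [b]} ⊆ D := Filter.eventually_ge_atTop _
    have e2 : ∀ᶠ f in nhds x, f ∈ UU n b := (isOpen_UU n b).mem_nhds hb
    filter_upwards [e1.prod_mk e2]
    rintro ⟨D, f⟩ ⟨hD, hf⟩
    have d1 : g D n = φ.1 n := hgd D n (hD (by simp))
    have d2 : g D (n ++ [b]) = φ.1 (n ++ [b]) := hgd D _ (hD (by simp))
    have l1 := loc_dO φ (append_ne n b)
    have l2 := loc_dO (gg D) (append_ne n b)
    change dO (g D n) (g D (n ++ [b])) = loc (g D) n _ at l2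
    rw [d1, d2, l1, dO_append] at l2
    change act (gg D) f (φ.1 n) = some (loc φ.1 n b)
    rw [l2, ← d1]
    refine (act_apply (gg D) f n).trans ?_
    rw [show f n = some b from hf]; rfl
  refine hK.induction_on (p := fun s => ∀ᶠ D in Filter.atTop, Set.MapsTo (act (gg D)) s U)
    (Filter.Eventually.of_forall fun D => Set.mapsTo_empty _ _) ?_ ?_ ?_
  · intro s t hst ht
    filter_upwards [ht] with D hD using hD.mono_left hst
  · intro s t hs ht
    filter_upwards [hs, ht] with D hD hD' using hD.union hD'
  · intro x hx
    have hxU : act φ x ∈ U := hKU hx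
    have := (hloc x).eventually (hU.mem_nhds hxU)
    rw [Filter.eventually_prod_iff] at this
    obtain ⟨pa, hpa, pb, hpb, hh⟩ := this
    refine ⟨{f | pb f}, mem_nhdsWithin_of_mem_nhds hpb, ?_⟩
    filter_upwards [hpa] with D hD f hf using hh hD hf

instance : Finite (Equiv.Perm (Lt k)) := inferInstance

lemma GX_fg : (GX k).FG := by
  have h1 : (GG k).FG := by
    rw [Subgroup.fg_iff]
    exact ⟨genS k, rfl, (Set.finite_range _).union (Set.toFinite _)⟩
  have : Group.FG (GG k) := (Group.fg_iff_subgroup_fg _).mpr h1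
  rw [← Group.fg_iff_subgroup_fg]
  exact Group.fg_range (rhoG k)

lemma GX_ab : Nonempty (Abelianization (GX k) ≃* Multiplicative (ZMod 2 × ℤ)) := by
  obtain ⟨e⟩ := GG_ab (k := k)
  exact ⟨((MonoidHom.ofInjective rhoG_inj).abelianizationCongr).symm.trans e⟩

lemma GX_index : (commutator (GX k)).index = 0 := by
  obtain ⟨e⟩ := GX_ab (k := k)
  change Nat.card (Abelianization (GX k)) = 0
  rw [Nat.card_congr e.toEquiv]
  have : Infinite (Multiplicative (ZMod 2 × ℤ)) :=
    inferInstanceAs (Infinite (ZMod 2 × ℤ))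
  exact Nat.card_eq_zero_of_infinite

end Waz

theorem statement2 (n : ℕ) (hn : 3 ≤ n) :
    ∃ (X : Type) (_ : TopologicalSpace X) (_ : IsWazewskiDendrite n X)
      (G : Subgroup (X ≃ₜ X)),
      G.FG ∧ Dense (G : Set (X ≃ₜ X)) ∧
      Nonempty (Abelianization G ≃* Multiplicative (ZMod 2 × ℤ)) ∧
      (commutator G).index = 0 := by
  obtain ⟨k, rfl⟩ : ∃ k, n = k + 2 := ⟨n - 2, by omega⟩
  exact ⟨Waz.XX k, inferInstance, Waz.waz k, Waz.GX k, Waz.GX_fg, Waz.GX_dense (by omega),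
    Waz.GX_ab, Waz.GX_index⟩
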